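/- arXiv:1712.03033 — 2 statements merged into one kernel-verified Lean document; each statement's English description precedes it below -/
import Mathlib

section
/- Let G be a simple 3-regular graph. Then G satisfies CD(0,∞) at every vertex if and only if G is isomorphic to a prism graph Y_n for some n ≥ 3 or to a Möbius ladder M_k for some k ≥ 2. -/
open Finset

variable {V : Type*}

/-- The non-normalized graph Laplacian: `Δ f (x) = ∑_{y ∼ x} (f y − f x)`. -/
noncomputable def graphLap (G : SimpleGraph V) [∀ v, Fintype (G.neighborSet v)]
    (f : V → ℝ) (x : V) : ℝ :=
  ∑ y ∈ G.neighborFinset x, (f y - f x)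

/-- The Bakry–Émery operator `Γ`: `2Γ(f,g) = Δ(fg) − fΔg − gΔf`. -/
noncomputable def graphGamma (G : SimpleGraph V) [∀ v, Fintype (G.neighborSet v)]
    (f g : V → ℝ) (x : V) : ℝ :=
  (graphLap G (fun z => f z * g z) x - f x * graphLap G g x - g x * graphLap G f x) / 2

/-- The Bakry–Émery operator `Γ₂`: `2Γ₂(f,g) = ΔΓ(f,g) − Γ(f,Δg) − Γ(Δf,g)`. -/
noncomputable def graphGamma2 (G : SimpleGraph V) [∀ v, Fintype (G.neighborSet v)]
    (f g : V → ℝ) (x : V) : ℝ :=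
  (graphLap G (graphGamma G f g) x - graphGamma G f (graphLap G g) x -
    graphGamma G (graphLap G f) g x) / 2

/-- A vertex `x` satisfies the curvature-dimension inequality `CD(0,∞)` if
`Γ₂(f)(x) ≥ 0` for all `f : V → ℝ`. -/
def SatisfiesCD (G : SimpleGraph V) [∀ v, Fintype (G.neighborSet v)] (x : V) : Prop :=
  ∀ f : V → ℝ, 0 ≤ graphGamma2 G f f x

open Classical in
/-- The idleness-0 probability measure `μ_x^0` at a vertex `x`. -/
noncomputable def muZero (G : SimpleGraph V) [∀ v, Fintype (G.neighborSet v)] (x : V) :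
    V → ℝ :=
  fun z => if G.Adj x z then 1 / (G.degree x : ℝ) else 0

/-- The Wasserstein distance `W₁(μ_x^0, μ_y^0)`: the infimum of the transport cost over
all couplings of `μ_x^0` and `μ_y^0`. -/
noncomputable def Wone (G : SimpleGraph V) [∀ v, Fintype (G.neighborSet v)] (x y : V) : ℝ :=
  sInf {w : ℝ | ∃ π : V → V → ℝ,
    (∀ u v, 0 ≤ π u v) ∧
    (∀ u v, π u v ≠ 0 → G.Adj x u ∧ G.Adj y v) ∧
    (∀ u, ∑ v ∈ G.neighborFinset y, π u v = muZero G x u) ∧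
    (∀ v, ∑ u ∈ G.neighborFinset x, π u v = muZero G y v) ∧
    w = ∑ u ∈ G.neighborFinset x, ∑ v ∈ G.neighborFinset y, (G.dist u v : ℝ) * π u v}

/-- The Ollivier–Ricci curvature with idleness `0`: `κ₀(x,y) = 1 − W₁(μ_x^0, μ_y^0)`. -/
noncomputable def kappaZero (G : SimpleGraph V) [∀ v, Fintype (G.neighborSet v)]
    (x y : V) : ℝ :=
  1 - Wone G x y

/-- The prism graph `Y n` on vertices `ZMod n × Bool`: two `n`-cycles joined by rungs;
equivalently the Cartesian product of the cycle `C_n` with `K₂`. -/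
def prismGraph (n : ℕ) : SimpleGraph (ZMod n × Bool) :=
  SimpleGraph.fromRel (fun p q => (p.2 = q.2 ∧ q.1 = p.1 + 1) ∨ (p.1 = q.1 ∧ p.2 ≠ q.2))

/-- The Möbius ladder `M n` on vertices `ZMod (2n)`: the cycle `C_{2n}` together with
all antipodal edges. -/
def mobiusLadder (n : ℕ) : SimpleGraph (ZMod (2 * n)) :=
  SimpleGraph.fromRel (fun p q => q = p + 1 ∨ q = p + (n : ZMod (2 * n)))

open Classical in
/-- The Laplacian matrix `L = D − A` of a finite graph. -/
noncomputable def lapMat (G : SimpleGraph V) [Fintype V] : Matrix V V ℝ :=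
  fun i j =>
    (if i = j then ∑ k : V, (if G.Adj i k then (1 : ℝ) else 0) else 0) -
      (if G.Adj i j then 1 else 0)

/-- `λ₁ G` : the smallest non-zero eigenvalue of the Laplacian matrix of `G`. -/
noncomputable def lambdaOne (G : SimpleGraph V) [Fintype V] : ℝ :=
  sInf {t : ℝ | t ≠ 0 ∧ ∃ v : V → ℝ, v ≠ 0 ∧ (lapMat G).mulVec v = t • v}

noncomputable instance fintypeNeighborSetOfFinite [Finite V] (G : SimpleGraph V) (v : V) :
    Fintype (G.neighborSet v) := Fintype.ofFinite _

section Curvature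

variable {G : SimpleGraph V} [∀ v, Fintype (G.neighborSet v)]

open Classical in
theorem neighborFinset_eq_of_degree_three {x l m r : V} (hx : G.degree x = 3)
    (h : ∀ y, G.Adj x y → y = l ∨ y = m ∨ y = r) : G.neighborFinset x = {l, m, r} := by
  refine Finset.eq_of_subset_of_card_le (fun y hy => ?_) ?_
  · simpa using h y (by simpa using hy)
  · rw [SimpleGraph.card_neighborFinset_eq_degree, hx]
    exact Finset.card_le_three

open Classical in
theorem graphLap_of_degree_three {x l m r : V} (hx : G.degree x = 3)
    (h : ∀ y, G.Adj x y → y = l ∨ y = m ∨ y = r) (f : V → ℝ) :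
    graphLap G f x = f l + f m + f r - 3 * f x := by
  have hN := neighborFinset_eq_of_degree_three hx h
  have hc : ({l, m, r} : Finset V).card = 3 := by
    rw [← hN, SimpleGraph.card_neighborFinset_eq_degree, hx]
  have hlm : l ≠ m := by
    rintro rfl
    have := Finset.card_le_two (a := l) (b := r)
    simp at hc
    omega
  have hlr : l ≠ r := by
    rintro rfl
    have := Finset.card_le_two (a := l) (b := m)
    rw [show ({l, m, l} : Finset V) = {l, m} by ext; simp; tauto] at hc
    omega
  have hmr : m ≠ r := by
    rintro rfl
    have := Finset.card_le_two (a := l) (b := m)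
    simp at hc
    omega
  rw [graphLap, hN, Finset.sum_insert (by simp [hlm, hlr]), Finset.sum_pair hmr]
  ring

/-- The curvature form at a vertex of a cubic graph in terms of the values of `f` on the
ball of radius two. -/
theorem four_mul_graphGamma2 (hcubic : ∀ v, G.degree v = 3) {x l m r l₁ l₂ m₁ m₂ r₁ r₂ : V}
    (hx : ∀ y, G.Adj x y → y = l ∨ y = m ∨ y = r)
    (hl : ∀ y, G.Adj l y → y = x ∨ y = l₁ ∨ y = l₂)
    (hm : ∀ y, G.Adj m y → y = x ∨ y = m₁ ∨ y = m₂)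
    (hr : ∀ y, G.Adj r y → y = x ∨ y = r₁ ∨ y = r₂) (f : V → ℝ) :
    4 * graphGamma2 G f f x =
      (f l₁ - 2 * f l + f x) ^ 2 + (f l₂ - 2 * f l + f x) ^ 2 +
      (f m₁ - 2 * f m + f x) ^ 2 + (f m₂ - 2 * f m + f x) ^ 2 +
      (f r₁ - 2 * f r + f x) ^ 2 + (f r₂ - 2 * f r + f x) ^ 2 +
      4 * ((f l - f x) * (f m - f x) + (f l - f x) * (f r - f x) +
        (f m - f x) * (f r - f x)) := by
  have Lx := graphLap_of_degree_three (hcubic x) hx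
  have Ll := graphLap_of_degree_three (hcubic l) hl
  have Lm := graphLap_of_degree_three (hcubic m) hm
  have Lr := graphLap_of_degree_three (hcubic r) hr
  simp only [graphGamma2, graphGamma, Lx, Ll, Lm, Lr]
  ring

/-- `CD(0,∞)` holds at a vertex whose ball of radius two looks like that of a ladder, with
rung `x m` and rails through `l, x, r` and `l', m, r'`. -/
theorem satisfiesCD_of_ladder (hcubic : ∀ v, G.degree v = 3) {x l m r l' l'' r' r'' : V}
    (hx : ∀ y, G.Adj x y → y = l ∨ y = m ∨ y = r)
    (hl : ∀ y, G.Adj l y → y = x ∨ y = l' ∨ y = l'')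
    (hm : ∀ y, G.Adj m y → y = x ∨ y = l' ∨ y = r')
    (hr : ∀ y, G.Adj r y → y = x ∨ y = r' ∨ y = r'') : SatisfiesCD G x := by
  intro f
  have h := four_mul_graphGamma2 hcubic hx hl hm hr f
  nlinarith [sq_nonneg (f l'' - 2 * f l + f x), sq_nonneg (f r'' - 2 * f r + f x),
    sq_nonneg ((f l' - 2 * f l + f x) + (f l' - 2 * f m + f x)),
    sq_nonneg ((f r' - 2 * f r + f x) + (f r' - 2 * f m + f x)),
    sq_nonneg (f l + f r - 2 * f x), sq_nonneg (f m - f x)]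

open Classical in
theorem exists_adj_iff_of_degree_three {x : V} (hx : G.degree x = 3) :
    ∃ l m r, l ≠ m ∧ l ≠ r ∧ m ≠ r ∧ ∀ y, G.Adj x y ↔ y = l ∨ y = m ∨ y = r := by
  obtain ⟨l, m, r, h₁, h₂, h₃, h⟩ := Finset.card_eq_three.1
    ((G.card_neighborFinset_eq_degree x).trans hx)
  refine ⟨l, m, r, h₁, h₂, h₃, fun y => ?_⟩
  rw [← SimpleGraph.mem_neighborFinset, h]
  simp

theorem exists_adj_iff_of_adj {x y : V} (hx : G.degree x = 3) (hy : G.Adj x y) :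
    ∃ m r, y ≠ m ∧ y ≠ r ∧ m ≠ r ∧ ∀ z, G.Adj x z ↔ z = y ∨ z = m ∨ z = r := by
  obtain ⟨l, m, r, h₁, h₂, h₃, h⟩ := exists_adj_iff_of_degree_three hx
  rcases (h y).1 hy with rfl | rfl | rfl
  · exact ⟨m, r, h₁, h₂, h₃, h⟩
  · exact ⟨l, r, h₁.symm, h₃, h₂, fun z => by rw [h]; tauto⟩
  · exact ⟨l, m, h₂.symm, h₃.symm, h₁, fun z => by rw [h]; tauto⟩

/-- Every edge lies on a cycle of length three or four. -/
def EdgesInShortCycles (G : SimpleGraph V) : Prop :=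
  ∀ x y, G.Adj x y → ∃ z, z ≠ y ∧ G.Adj x z ∧ (G.Adj y z ∨ ∃ w, w ≠ x ∧ G.Adj y w ∧ G.Adj z w)

open Classical in
theorem edgesInShortCycles_of_satisfiesCD (hcubic : ∀ v, G.degree v = 3)
    (hCD : ∀ x, SatisfiesCD G x) : EdgesInShortCycles G := by
  intro x y hxy
  by_contra! hno
  obtain ⟨p, q, hyp, hyq, hpq, hx⟩ := exists_adj_iff_of_adj (hcubic x) hxy
  have hxp : G.Adj x p := by simp [hx]
  have hxq : G.Adj x q := by simp [hx]
  obtain ⟨y₁, y₂, hy₁, hy₂, -, hy⟩ := exists_adj_iff_of_adj (hcubic y) hxy.symm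
  obtain ⟨p₁, p₂, hp₁, hp₂, -, hp⟩ := exists_adj_iff_of_adj (hcubic p) hxp.symm
  obtain ⟨q₁, q₂, hq₁, hq₂, -, hq⟩ := exists_adj_iff_of_adj (hcubic q) hxq.symm
  let f : V → ℝ := fun v => if v = x then 0 else if v = y then -2 else
    if v = p ∨ v = q then 1 else if G.Adj y v then -4 else 2
  have key := four_mul_graphGamma2 hcubic (fun z => (hx z).1) (fun z => (hy z).1)
    (fun z => (hp z).1) (fun z => (hq z).1) f
  have hnp := hno p hyp.symm hxp
  have hnq := hno q hyq.symm hxq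
  have fx : f x = 0 := by simp [f]
  have fy : f y = -2 := by simp [f, hxy.ne']
  have fp : f p = 1 := by simp [f, hxp.ne', hyp.symm]
  have fq : f q = 1 := by simp [f, hxq.ne', hyq.symm]
  have far : ∀ v, v ≠ x → G.Adj y v → f v = -4 := by
    intro v hv h
    have h₁ : v ≠ p := by rintro rfl; exact hnp.1 h
    have h₂ : v ≠ q := by rintro rfl; exact hnq.1 h
    simp [f, hv, h.ne', h₁, h₂, h]
  have near : ∀ v, v ≠ x → G.Adj p v ∨ G.Adj q v → f v = 1 ∨ f v = 2 := by
    intro v hv h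
    have h₁ : v ≠ y := by
      rintro rfl
      rcases h with h | h
      · exact hnp.1 h.symm
      · exact hnq.1 h.symm
    have h₂ : ¬ G.Adj y v := fun h' => by
      rcases h with h | h
      · exact hnp.2 v hv h' h
      · exact hnq.2 v hv h' h
    by_cases h₃ : v = p ∨ v = q <;> simp [f, hv, h₁, h₂, h₃]
  have bound : ∀ v, v ≠ x → G.Adj p v ∨ G.Adj q v → (f v - 2) ^ 2 ≤ 1 := by
    intro v hv h
    rcases near v hv h with h | h <;> rw [h] <;> norm_num
  have b₁ := bound p₁ hp₁.symm (by simp [hp])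
  have b₂ := bound p₂ hp₂.symm (by simp [hp])
  have b₃ := bound q₁ hq₁.symm (by simp [hq])
  have b₄ := bound q₂ hq₂.symm (by simp [hq])
  rw [far y₁ hy₁.symm (by simp [hy]), far y₂ hy₂.symm (by simp [hy]), fx, fy, fp, fq] at key
  have := hCD x f
  linarith

end Curvature

section Isomorphisms

variable {G : SimpleGraph V} [∀ v, Fintype (G.neighborSet v)]

theorem prismGraph_adj {n : ℕ} {p q : ZMod n × Bool} (h : (prismGraph n).Adj p q) :
    q = (p.1 - 1, p.2) ∨ q = (p.1, !p.2) ∨ q = (p.1 + 1, p.2) := by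
  obtain ⟨i, s⟩ := p
  obtain ⟨j, t⟩ := q
  simp only [prismGraph, SimpleGraph.fromRel_adj, Prod.mk.injEq] at h ⊢
  rcases h.2 with (⟨h₁, h₂⟩ | ⟨h₁, h₂⟩) | (⟨h₁, h₂⟩ | ⟨h₁, h₂⟩)
  · simp [h₁, h₂]
  · right; left
    exact ⟨h₁.symm, by cases s <;> cases t <;> simp_all⟩
  · left
    exact ⟨by rw [h₂]; ring, h₁⟩
  · right; left
    exact ⟨h₁, by cases s <;> cases t <;> simp_all⟩

theorem ZMod.natCast_add_self_two_mul (k : ℕ) : (k : ZMod (2 * k)) + k = 0 := by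
  have := ZMod.natCast_self (2 * k)
  push_cast at this
  rwa [← two_mul]

theorem mobiusLadder_adj {k : ℕ} {p q : ZMod (2 * k)} (h : (mobiusLadder k).Adj p q) :
    q = p - 1 ∨ q = p + k ∨ q = p + 1 := by
  have hk := ZMod.natCast_add_self_two_mul k
  simp only [mobiusLadder, SimpleGraph.fromRel_adj] at h
  rcases h.2 with (h | h) | (h | h)
  · simp [h]
  · simp [h]
  · left; rw [h]; ring
  · right; left; rw [h, add_assoc, hk, add_zero]

theorem satisfiesCD_of_iso_prismGraph (hcubic : ∀ v, G.degree v = 3) {n : ℕ}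
    (φ : G ≃g prismGraph n) (x : V) : SatisfiesCD G x := by
  have key : ∀ (p : ZMod n × Bool) (y : V), G.Adj (φ.symm p) y →
      y = φ.symm (p.1 - 1, p.2) ∨ y = φ.symm (p.1, !p.2) ∨ y = φ.symm (p.1 + 1, p.2) := by
    intro p y h
    have := prismGraph_adj (φ.map_adj_iff.2 h)
    simpa [← φ.symm_apply_eq, eq_comm] using this
  obtain ⟨⟨i, s⟩, rfl⟩ := φ.symm.surjective x
  refine satisfiesCD_of_ladder hcubic (l' := φ.symm (i - 1, !s)) (r' := φ.symm (i + 1, !s))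
    (l'' := φ.symm (i - 1 - 1, s)) (r'' := φ.symm (i + 1 + 1, s)) (key (i, s)) ?_ ?_ ?_
  · intro y h
    have := key _ y h
    simp only [sub_add_cancel] at this
    tauto
  · intro y h
    have := key _ y h
    simp only [Bool.not_not] at this
    tauto
  · intro y h
    have := key _ y h
    simp only [add_sub_cancel_right] at this
    tauto

theorem satisfiesCD_of_iso_mobiusLadder (hcubic : ∀ v, G.degree v = 3) {k : ℕ}
    (φ : G ≃g mobiusLadder k) (x : V) : SatisfiesCD G x := by
  have hk := ZMod.natCast_add_self_two_mul k
  have key : ∀ (p : ZMod (2 * k)) (y : V), G.Adj (φ.symm p) y →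
      y = φ.symm (p - 1) ∨ y = φ.symm (p + k) ∨ y = φ.symm (p + 1) := by
    intro p y h
    have := mobiusLadder_adj (φ.map_adj_iff.2 h)
    simpa [← φ.symm_apply_eq, eq_comm] using this
  obtain ⟨i, rfl⟩ := φ.symm.surjective x
  refine satisfiesCD_of_ladder hcubic (l' := φ.symm (i - 1 + k)) (r' := φ.symm (i + 1 + k))
    (l'' := φ.symm (i - 1 - 1)) (r'' := φ.symm (i + 1 + 1)) (key i) ?_ ?_ ?_
  · intro y h
    have := key _ y h
    rw [sub_add_cancel] at this
    tauto
  · intro y h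
    have := key _ y h
    rw [add_assoc i, hk, add_zero, add_sub_right_comm, add_right_comm] at this
    tauto
  · intro y h
    have := key _ y h
    rw [add_sub_cancel_right] at this
    tauto

/-- An injective homomorphism from a nonempty graph of minimal degree at least three to a
connected cubic graph is an isomorphism. -/
theorem nonempty_iso_of_injective {W : Type*} [Nonempty W] {H : SimpleGraph W}
    (hconn : G.Connected) (hcubic : ∀ v, G.degree v = 3) (φ : W → V)
    (hinj : Function.Injective φ) (hadj : ∀ p q, H.Adj p q → G.Adj (φ p) (φ q))
    (hdeg : ∀ p, ∃ q₁ q₂ q₃, q₁ ≠ q₂ ∧ q₁ ≠ q₃ ∧ q₂ ≠ q₃ ∧ H.Adj p q₁ ∧ H.Adj p q₂ ∧ H.Adj p q₃) :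
    Nonempty (G ≃g H) := by
  have lift : ∀ p v, G.Adj (φ p) v → ∃ q, H.Adj p q ∧ φ q = v := by
    intro p v hv
    obtain ⟨q₁, q₂, q₃, h₁₂, h₁₃, h₂₃, h₁, h₂, h₃⟩ := hdeg p
    obtain ⟨l, m, r, -, -, -, h⟩ := exists_adj_iff_of_degree_three (hcubic (φ p))
    have e₁ := (h _).1 (hadj _ _ h₁)
    have e₂ := (h _).1 (hadj _ _ h₂)
    have e₃ := (h _).1 (hadj _ _ h₃)
    have n₁₂ := hinj.ne h₁₂
    have n₁₃ := hinj.ne h₁₃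
    have n₂₃ := hinj.ne h₂₃
    have hv' := (h v).1 hv
    have : φ q₁ = v ∨ φ q₂ = v ∨ φ q₃ = v := by grind
    rcases this with h | h | h
    exacts [⟨q₁, h₁, h⟩, ⟨q₂, h₂, h⟩, ⟨q₃, h₃, h⟩]
  have hsurj : Function.Surjective φ := by
    intro v
    obtain ⟨p⟩ := ‹Nonempty W›
    obtain ⟨w⟩ := hconn.preconnected (φ p) v
    suffices ∀ u v, G.Walk u v → (∃ q, φ q = u) → ∃ q, φ q = v from this _ _ w ⟨p, rfl⟩
    intro u v w
    induction w with
    | nil => exact id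
    | cons h _ ih =>
      rintro ⟨q, rfl⟩
      obtain ⟨q', -, hq'⟩ := lift q _ h
      exact ih ⟨q', hq'⟩
  let e := Equiv.ofBijective φ ⟨hinj, hsurj⟩
  refine ⟨RelIso.symm ⟨e, fun {p q} => ⟨fun h => ?_, hadj p q⟩⟩⟩
  obtain ⟨q', h₁, h₂⟩ := lift p _ h
  rwa [← hinj h₂]

/-- A ladder with `n` rungs `a i, b i` embedded in `G` (not necessarily as an induced
subgraph). -/
structure IsLadder (G : SimpleGraph V) (n : ℕ) (a b : ℕ → V) : Prop where
  rung : ∀ i, i < n → G.Adj (a i) (b i)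
  left : ∀ i, i + 1 < n → G.Adj (a i) (a (i + 1))
  right : ∀ i, i + 1 < n → G.Adj (b i) (b (i + 1))
  inj_left : ∀ i j, i < n → j < n → a i = a j → i = j
  inj_right : ∀ i j, i < n → j < n → b i = b j → i = j
  disjoint : ∀ i j, i < n → j < n → a i ≠ b j

theorem IsLadder.nonempty_iso_prismGraph (hconn : G.Connected) (hcubic : ∀ v, G.degree v = 3)
    {n : ℕ} (hn : 3 ≤ n) {a b : ℕ → V} (h : IsLadder G n a b)
    (ha : G.Adj (a (n - 1)) (a 0)) (hb : G.Adj (b (n - 1)) (b 0)) :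
    Nonempty (G ≃g prismGraph n) := by
  have : NeZero n := ⟨by omega⟩
  have : Fact (1 < n) := ⟨by omega⟩
  have h1 : (1 : ZMod n) ≠ 0 := one_ne_zero
  have h2 : (2 : ZMod n) ≠ 0 := fun h => by
    have := (ZMod.natCast_eq_zero_iff 2 n).1 (by exact_mod_cast h)
    have := Nat.le_of_dvd (by norm_num) this
    omega
  have succ : ∀ i : ZMod n, (i + 1).val = i.val + 1 ∧ i.val + 1 < n ∨
      (i + 1).val = 0 ∧ i.val = n - 1 := by
    intro i
    have hi := i.val_lt
    rw [ZMod.val_add, ZMod.val_one]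
    rcases Nat.lt_or_ge (i.val + 1) n with h | h
    · exact .inl ⟨Nat.mod_eq_of_lt h, h⟩
    · have : i.val + 1 = n := by omega
      exact .inr ⟨by simp [this], by omega⟩
  have step : ∀ (i : ZMod n) (s : Bool), G.Adj (bif s then a i.val else b i.val)
      (bif s then a (i + 1).val else b (i + 1).val) := by
    intro i s
    rcases succ i with ⟨e, hi⟩ | ⟨e, hi⟩
    · cases s <;> simp only [cond_true, cond_false, e]
      exacts [h.right _ hi, h.left _ hi]
    · cases s <;> simp only [cond_true, cond_false, e, hi]
      exacts [hb, ha]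
  have rung : ∀ (i : ZMod n) (s t : Bool), s ≠ t → G.Adj (bif s then a i.val else b i.val)
      (bif t then a i.val else b i.val) := by
    intro i s t hst
    have := h.rung _ i.val_lt
    cases s <;> cases t <;> simp_all [this.symm]
  refine nonempty_iso_of_injective hconn hcubic
    (fun p => bif p.2 then a p.1.val else b p.1.val) ?_ ?_ ?_
  · rintro ⟨i, s⟩ ⟨j, t⟩ hij
    have hi := i.val_lt
    have hj := j.val_lt
    cases s <;> cases t <;> simp only [cond_true, cond_false] at hij
    · simpa using ZMod.val_injective n (h.inj_right _ _ hi hj hij)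
    · exact (h.disjoint _ _ hj hi hij.symm).elim
    · exact (h.disjoint _ _ hi hj hij).elim
    · simpa using ZMod.val_injective n (h.inj_left _ _ hi hj hij)
  · rintro ⟨i, s⟩ ⟨j, t⟩ hij
    simp only [prismGraph, SimpleGraph.fromRel_adj] at hij
    rcases hij.2 with (⟨rfl, rfl⟩ | ⟨rfl, h₂⟩) | (⟨rfl, rfl⟩ | ⟨rfl, h₂⟩)
    · exact step i _
    · exact rung i _ _ h₂
    · exact (step j _).symm
    · exact rung j _ _ h₂.symm
  · rintro ⟨i, s⟩
    refine ⟨(i - 1, s), (i + 1, s), (i, !s), ?_, by simp, by simp, ?_, ?_, ?_⟩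
    · intro h
      apply h2
      have := (Prod.mk.inj h).1
      linear_combination -this
    all_goals simp [prismGraph, h1, eq_sub_iff_add_eq]

theorem IsLadder.nonempty_iso_mobiusLadder (hconn : G.Connected)
    (hcubic : ∀ v, G.degree v = 3) {n : ℕ} (hn : 2 ≤ n) {a b : ℕ → V} (h : IsLadder G n a b)
    (ha : G.Adj (a (n - 1)) (b 0)) (hb : G.Adj (b (n - 1)) (a 0)) :
    Nonempty (G ≃g mobiusLadder n) := by
  have : NeZero (2 * n) := ⟨by omega⟩
  have : Fact (1 < 2 * n) := ⟨by omega⟩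
  have ne_zero : ∀ m : ℕ, 0 < m → m < 2 * n → (m : ZMod (2 * n)) ≠ 0 := fun m h h' e =>
    absurd (Nat.le_of_dvd h ((ZMod.natCast_eq_zero_iff m _).1 e)) (by omega)
  have h1 : (1 : ZMod (2 * n)) ≠ 0 := one_ne_zero
  have h2 : (2 : ZMod (2 * n)) ≠ 0 := by exact_mod_cast ne_zero 2 (by omega) (by omega)
  have hnz := ne_zero n (by omega) (by omega)
  have hn1 : (n : ZMod (2 * n)) + 1 ≠ 0 := by exact_mod_cast ne_zero (n + 1) (by omega) (by omega)
  have hn2 : (n : ZMod (2 * n)) - 1 ≠ 0 := by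
    have := ne_zero (n - 1) (by omega) (by omega)
    rwa [Nat.cast_sub (by omega), Nat.cast_one] at this
  let c : ℕ → V := fun i => if i < n then a i else b (i - n)
  have step : ∀ i : ZMod (2 * n), G.Adj (c i.val) (c (i + 1).val) := by
    intro i
    have hi := i.val_lt
    rw [ZMod.val_add, ZMod.val_one]
    rcases Nat.lt_or_ge (i.val + 1) (2 * n) with h' | h'
    · rw [Nat.mod_eq_of_lt h']
      rcases lt_trichotomy (i.val + 1) n with hlt | heq | hgt
      · simpa [c, hlt, show i.val < n by omega] using h.left _ hlt
      · have : i.val = n - 1 := by omega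
        simpa [c, heq, this, show n - 1 < n by omega, show n - 1 + 1 = n by omega] using ha
      · have := h.right (i.val - n) (by omega)
        simpa [c, show ¬ i.val < n by omega, show ¬ i.val + 1 < n by omega,
          show i.val + 1 - n = i.val - n + 1 by omega] using this
    · have : i.val = n + (n - 1) := by omega
      rw [show i.val + 1 = 2 * n by omega, Nat.mod_self, this]
      simpa [c, show 0 < n by omega] using hb
  have rung : ∀ i : ZMod (2 * n), G.Adj (c i.val) (c (i + n).val) := by
    intro i
    have hi := i.val_lt
    rw [ZMod.val_add, ZMod.val_natCast, Nat.mod_eq_of_lt (show n < 2 * n by omega)]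
    rcases Nat.lt_or_ge i.val n with h' | h'
    · rw [Nat.mod_eq_of_lt (by omega)]
      simpa [c, h'] using h.rung _ h'
    · have : i.val + n = i.val - n + 2 * n := by omega
      rw [this, Nat.add_mod_right, Nat.mod_eq_of_lt (by omega)]
      simpa [c, show ¬ i.val < n by omega, show i.val - n < n by omega] using
        (h.rung (i.val - n) (by omega)).symm
  refine nonempty_iso_of_injective hconn hcubic (fun p => c p.val) ?_ ?_ ?_
  · intro i j hij
    have hi := i.val_lt
    have hj := j.val_lt
    apply ZMod.val_injective (2 * n)
    simp only [c] at hij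
    split_ifs at hij with h₁ h₂ h₂
    · exact h.inj_left _ _ h₁ h₂ hij
    · exact (h.disjoint _ _ h₁ (by omega) hij).elim
    · exact (h.disjoint _ _ h₂ (by omega) hij.symm).elim
    · have := h.inj_right _ _ (by omega) (by omega) hij
      omega
  · intro i j hij
    simp only [mobiusLadder, SimpleGraph.fromRel_adj] at hij
    rcases hij.2 with (rfl | rfl) | (rfl | rfl)
    exacts [step i, rung i, (step j).symm, (rung j).symm]
  · intro i
    refine ⟨i - 1, i + 1, i + n, ?_, ?_, ?_, ?_, ?_, ?_⟩
    · intro h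
      apply h2
      linear_combination -h
    · intro h
      apply hn1
      linear_combination -h
    · intro h
      apply hn2
      linear_combination -h
    all_goals simp [mobiusLadder, h1, hnz, eq_sub_iff_add_eq]

end Isomorphisms

section Ladders

variable {G : SimpleGraph V} [∀ v, Fintype (G.neighborSet v)]

theorem adj_iff_of_degree_three {x p q r : V} (hx : G.degree x = 3) (hp : G.Adj x p)
    (hq : G.Adj x q) (hr : G.Adj x r) (hpq : p ≠ q) (hpr : p ≠ r) (hqr : q ≠ r) (v : V) :
    G.Adj x v ↔ v = p ∨ v = q ∨ v = r := by
  obtain ⟨m, s, -, -, -, h⟩ := exists_adj_iff_of_adj hx hp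
  have h₁ := h q
  have h₂ := h r
  have h₃ := h v
  grind

theorem exists_third_neighbor {x p q : V} (hx : G.degree x = 3) (hp : G.Adj x p)
    (hq : G.Adj x q) (hpq : p ≠ q) :
    ∃ r, p ≠ r ∧ q ≠ r ∧ ∀ v, G.Adj x v ↔ v = p ∨ v = q ∨ v = r := by
  obtain ⟨m, s, h₁, h₂, h₃, h⟩ := exists_adj_iff_of_adj hx hp
  rcases (h q).1 hq with rfl | rfl | rfl
  · exact absurd rfl hpq
  · exact ⟨s, h₂, h₃, h⟩
  · exact ⟨m, h₁, h₃.symm, fun v => by rw [h]; tauto⟩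

namespace IsLadder

variable {n : ℕ} {a b : ℕ → V}

omit [∀ v, Fintype (G.neighborSet v)] in
theorem swap (h : IsLadder G n a b) : IsLadder G n b a where
  rung i hi := (h.rung i hi).symm
  left := h.right
  right := h.left
  inj_left := h.inj_right
  inj_right := h.inj_left
  disjoint i j hi hj := (h.disjoint j i hj hi).symm

omit [∀ v, Fintype (G.neighborSet v)] in
theorem reverse (h : IsLadder G n a b) :
    IsLadder G n (fun i => a (n - 1 - i)) (fun i => b (n - 1 - i)) where
  rung i hi := h.rung _ (by omega)
  left i hi := by
    have := (h.left (n - 1 - (i + 1)) (by omega)).symm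
    rwa [show n - 1 - (i + 1) + 1 = n - 1 - i by omega] at this
  right i hi := by
    have := (h.right (n - 1 - (i + 1)) (by omega)).symm
    rwa [show n - 1 - (i + 1) + 1 = n - 1 - i by omega] at this
  inj_left i j hi hj e := by
    have := h.inj_left _ _ (by omega) (by omega) e
    omega
  inj_right i j hi hj e := by
    have := h.inj_right _ _ (by omega) (by omega) e
    omega
  disjoint i j hi hj := h.disjoint _ _ (by omega) (by omega)

omit [∀ v, Fintype (G.neighborSet v)] in
theorem extend (h : IsLadder G (n + 1) a b) {e f : V} (hef : G.Adj e f) (he : G.Adj (a n) e)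
    (hf : G.Adj (b n) f) (hea : ∀ i < n + 1, a i ≠ e) (heb : ∀ i < n + 1, b i ≠ e)
    (hfa : ∀ i < n + 1, a i ≠ f) (hfb : ∀ i < n + 1, b i ≠ f) :
    ∃ a' b', IsLadder G (n + 2) a' b' := by
  refine ⟨fun i => if i < n + 1 then a i else e, fun i => if i < n + 1 then b i else f,
    ?_, ?_, ?_, ?_, ?_, ?_⟩
  · intro i hi
    by_cases h₁ : i < n + 1
    · simpa [h₁] using h.rung i h₁
    · simpa [h₁] using hef
  · intro i hi
    by_cases h₁ : i < n
    · simpa [h₁, show i < n + 1 by omega] using h.left i (by omega)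
    · obtain rfl : i = n := by omega
      simpa using he
  · intro i hi
    by_cases h₁ : i < n
    · simpa [h₁, show i < n + 1 by omega] using h.right i (by omega)
    · obtain rfl : i = n := by omega
      simpa using hf
  · intro i j hi hj hij
    by_cases h₁ : i < n + 1 <;> by_cases h₂ : j < n + 1 <;> simp only [h₁, h₂, if_true, if_false] at hij
    · exact h.inj_left _ _ h₁ h₂ hij
    · exact (hea _ h₁ hij).elim
    · exact (hea _ h₂ hij.symm).elim
    · omega
  · intro i j hi hj hij
    by_cases h₁ : i < n + 1 <;> by_cases h₂ : j < n + 1 <;> simp only [h₁, h₂, if_true, if_false] at hij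
    · exact h.inj_right _ _ h₁ h₂ hij
    · exact (hfb _ h₁ hij).elim
    · exact (hfb _ h₂ hij.symm).elim
    · omega
  · intro i j hi hj hij
    by_cases h₁ : i < n + 1 <;> by_cases h₂ : j < n + 1 <;> simp only [h₁, h₂, if_true, if_false] at hij
    · exact h.disjoint _ _ h₁ h₂ hij
    · exact (hfa _ h₁ hij).elim
    · exact (heb _ h₂ hij.symm).elim
    · exact hef.ne hij

omit [∀ v, Fintype (G.neighborSet v)] in
theorem card_le [Fintype V] (h : IsLadder G n a b) : n ≤ Fintype.card V := by
  simpa using Fintype.card_le_of_injective (fun i : Fin n => a i)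
    fun i j hij => Fin.ext (h.inj_left _ _ i.2 j.2 hij)

omit [∀ v, Fintype (G.neighborSet v)] in
theorem exists_maximal [Fintype V] (h : IsLadder G n a b) :
    ∃ m a' b', n ≤ m ∧ IsLadder G m a' b' ∧ ∀ a'' b'', ¬ IsLadder G (m + 1) a'' b'' := by
  classical
  let P : ℕ → Prop := fun m => ∃ a' b', IsLadder G m a' b'
  have hn : P n := ⟨a, b, h⟩
  obtain ⟨a', b', h'⟩ := Nat.findGreatest_spec h.card_le hn
  refine ⟨_, a', b', Nat.le_findGreatest h.card_le hn, h', fun a'' b'' h'' => ?_⟩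
  exact Nat.findGreatest_is_greatest (Nat.lt_succ_self _) h''.card_le ⟨a'', b'', h''⟩

theorem adj_interior (hcubic : ∀ v, G.degree v = 3) (h : IsLadder G n a b) {i : ℕ}
    (hi : i + 2 < n) (v : V) :
    G.Adj (a (i + 1)) v ↔ v = a i ∨ v = a (i + 2) ∨ v = b (i + 1) :=
  adj_iff_of_degree_three (hcubic _) (h.left i (by omega)).symm (h.left (i + 1) (by omega))
    (h.rung (i + 1) (by omega))
    (fun e => by have := h.inj_left _ _ (by omega) (by omega) e; omega)
    (h.disjoint _ _ (by omega) (by omega)) (h.disjoint _ _ (by omega) (by omega)) v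

theorem adj_outside (hcubic : ∀ v, G.degree v = 3) (h : IsLadder G n a b) {e : V}
    (hea : ∀ i < n, a i ≠ e) (heb : ∀ i < n, b i ≠ e) {i : ℕ} (hi : i < n)
    (hie : G.Adj (a i) e) : i = 0 ∨ i + 1 = n := by
  by_contra! hne
  obtain ⟨j, rfl⟩ : ∃ j, i = j + 1 := ⟨i - 1, by omega⟩
  rcases (h.adj_interior hcubic (by omega) e).1 hie with r | r | r
  · exact hea j (by omega) r.symm
  · exact hea (j + 2) (by omega) r.symm
  · exact heb (j + 1) (by omega) r.symm

end IsLadder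

/-- No cubic graph with all edges in short cycles contains a ladder with three rungs together
with a common neighbor `e` of `a₀, a₂, b₀`. -/
theorem false_of_apex (hcubic : ∀ v, G.degree v = 3) (hG : EdgesInShortCycles G)
    {a₀ a₁ a₂ b₀ b₁ b₂ e : V} (hnd : [a₀, a₁, a₂, b₀, b₁, b₂, e].Nodup)
    (ha₀₁ : G.Adj a₀ a₁) (ha₁₂ : G.Adj a₁ a₂) (hb₀₁ : G.Adj b₀ b₁) (hb₁₂ : G.Adj b₁ b₂)
    (h₀ : G.Adj a₀ b₀) (h₁ : G.Adj a₁ b₁) (h₂ : G.Adj a₂ b₂)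
    (he₀ : G.Adj a₀ e) (he₂ : G.Adj a₂ e) (heb : G.Adj b₀ e) : False := by
  simp only [List.nodup_cons, List.mem_cons, List.not_mem_nil, or_false, not_or,
    List.nodup_nil, and_true, not_false_eq_true] at hnd
  have A₀ := adj_iff_of_degree_three (hcubic a₀) ha₀₁ h₀ he₀ (by tauto) (by tauto) (by tauto)
  have A₁ := adj_iff_of_degree_three (hcubic a₁) ha₀₁.symm ha₁₂ h₁ (by tauto) (by tauto) (by tauto)
  have A₂ := adj_iff_of_degree_three (hcubic a₂) ha₁₂.symm h₂ he₂ (by tauto) (by tauto) (by tauto)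
  have B₀ := adj_iff_of_degree_three (hcubic b₀) h₀.symm hb₀₁ heb (by tauto) (by tauto) (by tauto)
  have B₁ := adj_iff_of_degree_three (hcubic b₁) hb₀₁.symm hb₁₂ h₁.symm
    (by tauto) (by grind) (by grind)
  have E := adj_iff_of_degree_three (hcubic e) he₀.symm he₂.symm heb.symm
    (by tauto) (by tauto) (by tauto)
  obtain ⟨k, hk₁, hk₂, B₂⟩ := exists_third_neighbor (hcubic b₂) h₂.symm hb₁₂.symm (by tauto)
  have hbk : G.Adj b₂ k := by simp [B₂]
  have hkb := hbk.symm
  have hk_ne := hbk.ne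
  obtain ⟨z, hz, hbz, hkz⟩ := hG b₂ k hbk
  have hk := fun v => G.adj_comm k v
  grind

/-- A ladder with three rungs whose left rail closes up to a 4-cycle `a₀ a₁ a₂ e` off the
ladder extends at one of its ends. -/
theorem false_of_three_rungs (hcubic : ∀ v, G.degree v = 3) (hG : EdgesInShortCycles G)
    {a₀ a₁ a₂ b₀ b₁ b₂ e : V} (hnd : [a₀, a₁, a₂, b₀, b₁, b₂, e].Nodup)
    (ha₀₁ : G.Adj a₀ a₁) (ha₁₂ : G.Adj a₁ a₂) (hb₀₁ : G.Adj b₀ b₁) (hb₁₂ : G.Adj b₁ b₂)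
    (h₀ : G.Adj a₀ b₀) (h₁ : G.Adj a₁ b₁) (h₂ : G.Adj a₂ b₂)
    (he₀ : G.Adj a₀ e) (he₂ : G.Adj a₂ e)
    (hno₀ : ∀ f, f ∉ [a₀, a₁, a₂, b₀, b₁, b₂] → G.Adj e f → ¬ G.Adj b₀ f)
    (hno₂ : ∀ f, f ∉ [a₀, a₁, a₂, b₀, b₁, b₂] → G.Adj e f → ¬ G.Adj b₂ f) : False := by
  have nb₀ : ¬ G.Adj b₀ e := fun h =>
    false_of_apex hcubic hG hnd ha₀₁ ha₁₂ hb₀₁ hb₁₂ h₀ h₁ h₂ he₀ he₂ h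
  have nb₂ : ¬ G.Adj b₂ e := fun h =>
    false_of_apex hcubic hG (a₀ := a₂) (a₁ := a₁) (a₂ := a₀) (b₀ := b₂) (b₁ := b₁) (b₂ := b₀)
      (e := e) (by simp only [List.nodup_cons, List.mem_cons] at hnd ⊢; grind) ha₁₂.symm
      ha₀₁.symm hb₁₂.symm hb₀₁.symm h₂ h₁ h₀ he₂ he₀ h
  simp only [List.nodup_cons, List.mem_cons, List.not_mem_nil, or_false, not_or,
    List.nodup_nil, and_true, not_false_eq_true] at hnd hno₀ hno₂
  have A₀ := adj_iff_of_degree_three (hcubic a₀) ha₀₁ h₀ he₀ (by tauto) (by tauto) (by tauto)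
  have A₁ := adj_iff_of_degree_three (hcubic a₁) ha₀₁.symm ha₁₂ h₁ (by tauto) (by tauto) (by tauto)
  have A₂ := adj_iff_of_degree_three (hcubic a₂) ha₁₂.symm h₂ he₂ (by tauto) (by tauto) (by tauto)
  have B₁ := adj_iff_of_degree_three (hcubic b₁) hb₀₁.symm hb₁₂ h₁.symm
    (by tauto) (by grind) (by grind)
  obtain ⟨g, hg₀, hg₂, E⟩ := exists_third_neighbor (hcubic e) he₀.symm he₂.symm (by tauto)
  have heg : G.Adj e g := by simp [E]
  have hgs := fun v => G.adj_comm g v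
  have hge := heg.ne'
  have ha₁ := (A₁ e).1
  have hb₁ := (B₁ e).1
  have := hno₀ g (by grind) heg
  have := hno₂ g (by grind) heg
  obtain ⟨z, hz, hez, hgz⟩ := hG e g heg
  grind

theorem IsLadder.not_adj_of_outside (hcubic : ∀ v, G.degree v = 3) (hG : EdgesInShortCycles G)
    {m : ℕ} {a b : ℕ → V} (h : IsLadder G (m + 3) a b)
    (hmax : ∀ a' b', ¬ IsLadder G (m + 4) a' b') {e : V} (he : G.Adj (a (m + 2)) e)
    (hea : ∀ i < m + 3, a i ≠ e) (heb : ∀ i < m + 3, b i ≠ e) : ¬ G.Adj (a m) e := by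
  intro hm
  obtain rfl : m = 0 := by
    have := h.adj_outside hcubic hea heb (by omega) hm
    omega
  have hnd : [a 0, a 1, a 2, b 0, b 1, b 2, e].Nodup := by
    simp only [List.nodup_cons, List.mem_cons, List.not_mem_nil, or_false, not_or,
      List.nodup_nil, and_true, not_false_eq_true]
    have d := fun i j (hi : i < 3) (hj : j < 3) => h.disjoint i j (by omega) (by omega)
    have l := fun i j (hi : i < 3) (hj : j < 3) => h.inj_left i j (by omega) (by omega)
    have r := fun i j (hi : i < 3) (hj : j < 3) => h.inj_right i j (by omega) (by omega)
    grind
  have out : ∀ f, f ∉ [a 0, a 1, a 2, b 0, b 1, b 2] →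
      (∀ i < 3, a i ≠ f) ∧ ∀ i < 3, b i ≠ f := by
    intro f hf
    simp only [List.mem_cons, List.not_mem_nil, or_false, not_or] at hf
    constructor <;> intro i hi <;> interval_cases i <;> grind
  refine false_of_three_rungs hcubic hG hnd (h.left 0 (by omega)) (h.left 1 (by omega))
    (h.right 0 (by omega)) (h.right 1 (by omega)) (h.rung 0 (by omega)) (h.rung 1 (by omega))
    (h.rung 2 (by omega)) hm he ?_ ?_
  · intro f hf hef hbf
    obtain ⟨a', b', h'⟩ := h.reverse.extend hef hm hbf (fun i _ => hea _ (by omega))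
      (fun i _ => heb _ (by omega)) (fun i _ => (out f hf).1 _ (by omega))
      (fun i _ => (out f hf).2 _ (by omega))
    exact hmax _ _ h'
  · intro f hf hef hbf
    obtain ⟨a', b', h'⟩ := h.extend hef he hbf hea heb (out f hf).1 (out f hf).2
    exact hmax _ _ h'

theorem IsLadder.false_of_outside (hcubic : ∀ v, G.degree v = 3) (hG : EdgesInShortCycles G)
    {m : ℕ} {a b : ℕ → V} (h : IsLadder G (m + 3) a b)
    (hmax : ∀ a' b', ¬ IsLadder G (m + 4) a' b') {e : V} (he : G.Adj (a (m + 2)) e)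
    (hea : ∀ i < m + 3, a i ≠ e) (heb : ∀ i < m + 3, b i ≠ e) : False := by
  have ra₁ : ¬ G.Adj (a (m + 1)) e := fun r => by
    have := h.adj_outside hcubic hea heb (by omega) r
    omega
  have rb₁ : ¬ G.Adj (b (m + 1)) e := fun r => by
    have := h.swap.adj_outside hcubic heb hea (by omega) r
    omega
  have ra₀ := h.not_adj_of_outside hcubic hG hmax he hea heb
  have A₁ := h.adj_interior hcubic (i := m) (by omega)
  have B₁ := h.swap.adj_interior hcubic (i := m) (by omega)
  have ca : a (m + 1) ≠ e := hea _ (by omega)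
  have cb : b (m + 2) ≠ e := heb _ (by omega)
  have cab : a (m + 1) ≠ b (m + 2) := h.disjoint _ _ (by omega) (by omega)
  have cba : b (m + 1) ≠ a (m + 2) := (h.disjoint _ _ (by omega) (by omega)).symm
  have C := adj_iff_of_degree_three (hcubic (a (m + 2))) (h.left (m + 1) (by omega)).symm
    (h.rung (m + 2) (by omega)) he cab ca cb
  have hes := fun v => G.adj_comm e v
  have noTri : ¬ G.Adj (b (m + 2)) e := by
    intro hbe
    have rb₀ := h.swap.not_adj_of_outside hcubic hG (fun a' b' h' => hmax _ _ h'.swap) hbe heb hea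
    have D := adj_iff_of_degree_three (hcubic (b (m + 2))) (h.right (m + 1) (by omega)).symm
      (h.rung (m + 2) (by omega)).symm hbe cba (heb _ (by omega)) (hea _ (by omega))
    obtain ⟨g, hg₁, hg₂, E⟩ := exists_third_neighbor (hcubic e) he.symm hbe.symm
      (h.disjoint _ _ (by omega) (by omega))
    have heg : G.Adj e g := by simp [E]
    have hge := heg.ne'
    have hgs := fun v => G.adj_comm g v
    obtain ⟨z, hz, hez, hgz⟩ := hG e g heg
    grind
  obtain ⟨f, hf₁, hf₂, D⟩ := exists_third_neighbor (hcubic (b (m + 2)))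
    (h.right (m + 1) (by omega)).symm (h.rung (m + 2) (by omega)).symm cba
  have hbf : G.Adj (b (m + 2)) f := by simp [D]
  have hef : G.Adj e f := by
    obtain ⟨z, hz, hcz, hez⟩ := hG _ e he
    grind
  have inside : (∃ i < m + 3, a i = f) ∨ ∃ i < m + 3, b i = f := by
    by_contra! hout
    obtain ⟨a', b', h'⟩ := h.extend hef he hbf hea heb hout.1 hout.2
    exact hmax _ _ h'
  rcases inside with ⟨i, hi, rfl⟩ | ⟨i, hi, rfl⟩
  · rcases h.adj_outside hcubic hea heb hi hef.symm with rfl | hi'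
    · have A₀ := adj_iff_of_degree_three (hcubic (a 0)) (h.left 0 (by omega))
        (h.rung 0 (by omega)) hef.symm (h.disjoint _ _ (by omega) (by omega))
        (hea _ (by omega)) (heb _ (by omega)) (b (m + 2))
      rcases A₀.1 hbf.symm with r | r | r
      · exact h.disjoint _ _ (by omega) (by omega) r.symm
      · have := h.inj_right _ _ (by omega) (by omega) r
        omega
      · exact cb r
    · obtain rfl : i = m + 2 := by omega
      exact hf₂ rfl
  · rcases h.swap.adj_outside hcubic heb hea hi hef.symm with rfl | hi'
    · have B₀ := adj_iff_of_degree_three (hcubic (b 0)) (h.right 0 (by omega))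
        (h.rung 0 (by omega)).symm hef.symm (h.disjoint _ _ (by omega) (by omega)).symm
        (heb _ (by omega)) (hea _ (by omega)) (b (m + 2))
      rcases B₀.1 hbf.symm with r | r | r
      · have := h.inj_right _ _ (by omega) (by omega) r
        omega
      · exact h.disjoint _ _ (by omega) (by omega) r.symm
      · exact cb r
    · obtain rfl : i = m + 2 := by omega
      exact hbf.ne rfl

/-- In a maximal ladder with at least three rungs, the third neighbor of an end vertex is an
end vertex of the opposite end. -/
theorem IsLadder.third_neighbor_mem (hcubic : ∀ v, G.degree v = 3) (hG : EdgesInShortCycles G)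
    {m : ℕ} {a b : ℕ → V} (h : IsLadder G (m + 3) a b)
    (hmax : ∀ a' b', ¬ IsLadder G (m + 4) a' b') {e : V} (he : G.Adj (a (m + 2)) e)
    (hea : e ≠ a (m + 1)) (heb : e ≠ b (m + 2)) : e = a 0 ∨ e = b 0 := by
  have inside : (∃ i < m + 3, a i = e) ∨ ∃ i < m + 3, b i = e := by
    by_contra! hout
    exact h.false_of_outside hcubic hG hmax he hout.1 hout.2
  rcases inside with ⟨i, hi, rfl⟩ | ⟨i, hi, rfl⟩
  · rcases i with _ | j
    · exact .inl rfl
    · rcases Nat.lt_or_ge (j + 2) (m + 3) with hj | hj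
      · rcases (h.adj_interior hcubic hj _).1 he.symm with r | r | r
        · have := h.inj_left _ _ (by omega) (by omega) r
          omega
        · have := h.inj_left _ _ (by omega) (by omega) r
          obtain rfl : j = m := by omega
          exact (hea rfl).elim
        · exact (h.disjoint _ _ (by omega) (by omega) r).elim
      · obtain rfl : j = m + 1 := by omega
        exact (he.ne rfl).elim
  · rcases i with _ | j
    · exact .inr rfl
    · rcases Nat.lt_or_ge (j + 2) (m + 3) with hj | hj
      · rcases (h.swap.adj_interior hcubic hj _).1 he.symm with r | r | r
        · exact (h.disjoint _ _ (by omega) (by omega) r).elim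
        · exact (h.disjoint _ _ (by omega) (by omega) r).elim
        · have := h.inj_left _ _ (by omega) (by omega) r
          omega
      · obtain rfl : j = m + 1 := by omega
        exact (heb rfl).elim

omit [∀ v, Fintype (G.neighborSet v)] in
theorem IsLadder.of_four_cycle {p q r s : V} (hnd : [p, q, r, s].Nodup) (hpq : G.Adj p q)
    (hqr : G.Adj q r) (hrs : G.Adj r s) (hsp : G.Adj s p) :
    IsLadder G 2 (fun i => if i = 0 then p else q) (fun i => if i = 0 then s else r) := by
  simp only [List.nodup_cons, List.mem_cons, List.not_mem_nil, or_false, not_or,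
    List.nodup_nil, and_true, not_false_eq_true] at hnd
  refine ⟨?_, ?_, ?_, ?_, ?_, ?_⟩
  · intro i hi
    interval_cases i
    exacts [hsp.symm, hqr]
  · intro i hi
    obtain rfl : i = 0 := by omega
    exact hpq
  · intro i hi
    obtain rfl : i = 0 := by omega
    exact hrs.symm
  all_goals
    intro i j hi hj
    interval_cases i <;> interval_cases j <;> grind

omit [∀ v, Fintype (G.neighborSet v)] in
theorem IsLadder.of_three_rungs {a₀ a₁ a₂ b₀ b₁ b₂ : V} (hnd : [a₀, a₁, a₂, b₀, b₁, b₂].Nodup)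
    (ha₀₁ : G.Adj a₀ a₁) (ha₁₂ : G.Adj a₁ a₂) (hb₀₁ : G.Adj b₀ b₁) (hb₁₂ : G.Adj b₁ b₂)
    (h₀ : G.Adj a₀ b₀) (h₁ : G.Adj a₁ b₁) (h₂ : G.Adj a₂ b₂) :
    IsLadder G 3 (fun i => if i = 0 then a₀ else if i = 1 then a₁ else a₂)
      (fun i => if i = 0 then b₀ else if i = 1 then b₁ else b₂) := by
  simp only [List.nodup_cons, List.mem_cons, List.not_mem_nil, or_false, not_or,
    List.nodup_nil, and_true, not_false_eq_true] at hnd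
  refine ⟨?_, ?_, ?_, ?_, ?_, ?_⟩
  · intro i hi
    interval_cases i
    exacts [h₀, h₁, h₂]
  · intro i hi
    obtain rfl | rfl : i = 0 ∨ i = 1 := by omega
    exacts [ha₀₁, ha₁₂]
  · intro i hi
    obtain rfl | rfl : i = 0 ∨ i = 1 := by omega
    exacts [hb₀₁, hb₁₂]
  all_goals
    intro i j hi hj
    interval_cases i <;> interval_cases j <;> grind

theorem exists_four_cycle [Nonempty V] (hcubic : ∀ v, G.degree v = 3)
    (hG : EdgesInShortCycles G) : ∃ p q r s, [p, q, r, s].Nodup ∧ G.Adj p q ∧ G.Adj q r ∧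
      G.Adj r s ∧ G.Adj s p := by
  obtain ⟨x⟩ := ‹Nonempty V›
  obtain ⟨y, m, r, -, -, -, hy⟩ := exists_adj_iff_of_degree_three (hcubic x)
  have hxy : G.Adj x y := by simp [hy]
  have square : ∀ y z w, G.Adj x y → z ≠ y → G.Adj x z → w ≠ x → G.Adj y w → G.Adj z w →
      ∃ p q r s, [p, q, r, s].Nodup ∧ G.Adj p q ∧ G.Adj q r ∧ G.Adj r s ∧ G.Adj s p := by
    intro y z w hxy hzy hxz hw hyw hzw
    refine ⟨x, y, w, z, ?_, hxy, hyw, hzw.symm, hxz.symm⟩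
    simp [hxy.ne, hxz.ne, hw.symm, hyw.ne, hzy.symm, hzw.ne']
  obtain ⟨z, hzy, hxz, hyz | ⟨w, hw, hyw, hzw⟩⟩ := hG x y hxy
  · obtain ⟨t, hty, htz, hx⟩ := exists_third_neighbor (hcubic x) hxy hxz hzy.symm
    have hxt : G.Adj x t := by simp [hx]
    obtain ⟨u, hut, hxu, htu | ⟨w, hw, htw, huw⟩⟩ := hG x t hxt
    · rcases (hx u).1 hxu with rfl | rfl | rfl
      · exact square t z u hxt htz hxz hxu.ne' htu hyz.symm
      · exact square t y u hxt hty hxy hxu.ne' htu hyz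
      · exact absurd rfl hut
    · exact square t u w hxt hut hxu hw htw huw
  · exact square y z w hxy hzy hxz hw hyw hzw

/-- If all edges lie in short cycles, a 4-cycle with one chord also has the other chord. -/
theorem adj_of_adj_of_four_cycle (hcubic : ∀ v, G.degree v = 3) (hG : EdgesInShortCycles G)
    {p q r s : V} (hnd : [p, q, r, s].Nodup) (hpq : G.Adj p q) (hqr : G.Adj q r)
    (hrs : G.Adj r s) (hsp : G.Adj s p) (hpr : G.Adj p r) : G.Adj q s := by
  by_contra hqs
  simp only [List.nodup_cons, List.mem_cons, List.not_mem_nil, or_false, not_or,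
    List.nodup_nil, and_true, not_false_eq_true] at hnd
  have P := adj_iff_of_degree_three (hcubic p) hpq hsp.symm hpr (by tauto) (by tauto) (by grind)
  have R := adj_iff_of_degree_three (hcubic r) hqr.symm hrs hpr.symm
    (by tauto) (by grind) (by grind)
  obtain ⟨e, he₁, he₂, Q⟩ := exists_third_neighbor (hcubic q) hpq.symm hqr (by tauto)
  obtain ⟨f, hf₁, hf₂, S⟩ := exists_third_neighbor (hcubic s) hsp hrs.symm (by tauto)
  have hqe : G.Adj q e := by simp [Q]
  have hse : G.Adj s e := by
    have hne := hqe.ne'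
    have hes : e ≠ s := fun h => hqs (h ▸ hqe)
    have hpe : ¬ G.Adj p e := by simp [P, hne, hes, he₂.symm]
    have hre : ¬ G.Adj r e := by simp [R, hne, hes, he₁.symm]
    obtain ⟨z, hz, hqz, h⟩ := hG q e hqe
    have hez : ¬ G.Adj e z := by
      rcases (Q z).1 hqz with rfl | rfl | rfl
      exacts [fun h => hpe h.symm, fun h => hre h.symm, absurd rfl hz]
    obtain ⟨w, hw, hew, hzw⟩ := h.resolve_left hez
    have hwp : w ≠ p := by rintro rfl; exact hpe hew.symm
    have hwr : w ≠ r := by rintro rfl; exact hre hew.symm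
    have hws : w = s := by
      rcases (Q z).1 hqz with rfl | rfl | rfl
      · simpa [hw, hwr] using (P w).1 hzw
      · simpa [hw, hwp] using (R w).1 hzw
      · exact absurd rfl hz
    exact hws ▸ hew.symm
  obtain ⟨g, hg₁, hg₂, E⟩ := exists_third_neighbor (hcubic e) hqe.symm hse.symm (by tauto)
  have heg : G.Adj e g := by simp [E]
  have := heg.ne'
  have := fun v => G.adj_comm e v
  have := fun v => G.adj_comm g v
  obtain ⟨z, hz, hez, hgz⟩ := hG e g heg
  grind

/-- If two opposite edges of a 4-cycle lie on triangles with apexes `e, f` off the cycle, then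
`e` and `f` are adjacent. -/
theorem adj_of_triangles (hcubic : ∀ v, G.degree v = 3) (hG : EdgesInShortCycles G)
    {p q r s e f : V} (hnd : [p, q, r, s, e, f].Nodup) (hpq : G.Adj p q) (hqr : G.Adj q r)
    (hrs : G.Adj r s) (hsp : G.Adj s p) (hpe : G.Adj p e) (hqe : G.Adj q e) (hrf : G.Adj r f)
    (hsf : G.Adj s f) : G.Adj e f := by
  by_contra hef
  simp only [List.nodup_cons, List.mem_cons, List.not_mem_nil, or_false, not_or,
    List.nodup_nil, and_true, not_false_eq_true] at hnd
  have P := adj_iff_of_degree_three (hcubic p) hpq hsp.symm hpe (by tauto) (by tauto) (by tauto)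
  have Q := adj_iff_of_degree_three (hcubic q) hpq.symm hqr hqe (by tauto) (by tauto) (by tauto)
  have R := adj_iff_of_degree_three (hcubic r) hqr.symm hrs hrf (by tauto) (by tauto) (by tauto)
  have S := adj_iff_of_degree_three (hcubic s) hsp hrs.symm hsf (by tauto) (by tauto) (by tauto)
  obtain ⟨g, hg₁, hg₂, E⟩ := exists_third_neighbor (hcubic e) hpe.symm hqe.symm (by tauto)
  have heg : G.Adj e g := by simp [E]
  have := heg.ne'
  have := fun v => G.adj_comm e v
  have := fun v => G.adj_comm g v
  obtain ⟨z, hz, hez, hgz⟩ := hG e g heg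
  grind

omit [∀ v, Fintype (G.neighborSet v)] in
theorem third_neighbor_mem_of_four_cycle (hG : EdgesInShortCycles G) {p q r s e f g k : V}
    (P : ∀ v, G.Adj p v ↔ v = q ∨ v = s ∨ v = e) (Q : ∀ v, G.Adj q v ↔ v = p ∨ v = r ∨ v = f)
    (R : ∀ v, G.Adj r v ↔ v = q ∨ v = s ∨ v = g) (S : ∀ v, G.Adj s v ↔ v = r ∨ v = p ∨ v = k)
    (he : e ≠ p ∧ e ≠ q ∧ e ≠ r ∧ e ≠ s) (hef : ¬ G.Adj e f) (hek : ¬ G.Adj e k) :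
    e = f ∨ e = g ∨ e = k := by
  obtain ⟨hep, heq, her, hes⟩ := he
  have hq : G.Adj e q → e = f := fun h => by simpa [hep, her] using (Q e).1 h.symm
  have hs : G.Adj e s → e = k := fun h => by simpa [hep, her] using (S e).1 h.symm
  have hr : G.Adj e r → e = g := fun h => by simpa [heq, hes] using (R e).1 h.symm
  obtain ⟨z, hz, hpz, hez | ⟨w, hw, hew, hzw⟩⟩ := hG p e (by simp [P])
  · rcases (P z).1 hpz with rfl | rfl | rfl
    exacts [.inl (hq hez), .inr (.inr (hs hez)), absurd rfl hz]
  · rcases (P z).1 hpz with rfl | rfl | rfl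
    · rcases (Q w).1 hzw with rfl | rfl | rfl
      exacts [absurd rfl hw, .inr (.inl (hr hew)), absurd hew hef]
    · rcases (S w).1 hzw with rfl | rfl | rfl
      exacts [.inr (.inl (hr hew)), absurd rfl hw, absurd hew hek]
    · exact absurd rfl hz

set_option maxHeartbeats 1000000 in
/-- A 4-cycle without chords extends to a ladder with three rungs. -/
theorem exists_isLadder_three (hcubic : ∀ v, G.degree v = 3) (hG : EdgesInShortCycles G)
    {p q r s : V} (hnd : [p, q, r, s].Nodup) (hpq : G.Adj p q) (hqr : G.Adj q r)
    (hrs : G.Adj r s) (hsp : G.Adj s p) (hpr : ¬ G.Adj p r) (hqs : ¬ G.Adj q s) :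
    ∃ a b, IsLadder G 3 a b := by
  by_contra! hno
  have no : ∀ a₀ a₁ a₂ b₀ b₁ b₂ : V, [a₀, a₁, a₂, b₀, b₁, b₂].Nodup → G.Adj a₀ a₁ → G.Adj a₁ a₂ →
      G.Adj b₀ b₁ → G.Adj b₁ b₂ → G.Adj a₀ b₀ → G.Adj a₁ b₁ → G.Adj a₂ b₂ → False :=
    fun _ _ _ _ _ _ h₁ h₂ h₃ h₄ h₅ h₆ h₇ h₈ =>
      hno _ _ (IsLadder.of_three_rungs h₁ h₂ h₃ h₄ h₅ h₆ h₇ h₈)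
  simp only [List.nodup_cons, List.mem_cons, List.not_mem_nil, or_false, not_or,
    List.nodup_nil, and_true, not_false_eq_true] at hnd no
  obtain ⟨e, he₁, he₂, P⟩ := exists_third_neighbor (hcubic p) hpq hsp.symm (by tauto)
  obtain ⟨f, hf₁, hf₂, Q⟩ := exists_third_neighbor (hcubic q) hpq.symm hqr (by tauto)
  obtain ⟨g, hg₁, hg₂, R⟩ := exists_third_neighbor (hcubic r) hqr.symm hrs (by tauto)
  obtain ⟨k, hk₁, hk₂, S⟩ := exists_third_neighbor (hcubic s) hrs.symm hsp (by tauto)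
  have hpe : G.Adj p e := by simp [P]
  have hqf : G.Adj q f := by simp [Q]
  have hrg : G.Adj r g := by simp [R]
  have hsk : G.Adj s k := by simp [S]
  have he : e ≠ p ∧ e ≠ q ∧ e ≠ r ∧ e ≠ s := ⟨hpe.ne', he₁.symm, by grind, he₂.symm⟩
  have hf : f ≠ p ∧ f ≠ q ∧ f ≠ r ∧ f ≠ s := ⟨hf₁.symm, hqf.ne', hf₂.symm, by grind⟩
  have hg : g ≠ p ∧ g ≠ q ∧ g ≠ r ∧ g ≠ s :=
    ⟨by have := hrg.symm; grind, hg₁.symm, hrg.ne', hg₂.symm⟩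
  have hk : k ≠ p ∧ k ≠ q ∧ k ≠ r ∧ k ≠ s :=
    ⟨hk₂.symm, by have := hsk.symm; grind, hk₁.symm, hsk.ne'⟩
  have nef : ¬ G.Adj e f := fun h => no e p s f q r (by have := h.ne; grind) hpe.symm hsp.symm
    hqf.symm hqr h hpq hrs.symm
  have nfg : ¬ G.Adj f g := fun h => no f q p g r s (by have := h.ne; grind) hqf.symm hpq.symm
    hrg.symm hrs h hqr hsp.symm
  have ngk : ¬ G.Adj g k := fun h => no g r q k s p (by have := h.ne; grind) hrg.symm hqr.symm
    hsk.symm hsp h hrs hpq.symm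
  have nke : ¬ G.Adj k e := fun h => no k s r e p q (by have := h.ne; grind) hsk.symm hrs.symm
    hpe.symm hpq h hsp hqr.symm
  clear hno
  have se : e = f ∨ e = g ∨ e = k :=
    third_neighbor_mem_of_four_cycle hG P Q R S he nef (fun h => nke h.symm)
  have P' v := (P v).trans or_left_comm
  have Q' v := (Q v).trans or_left_comm
  have R' v := (R v).trans or_left_comm
  have S' v := (S v).trans or_left_comm
  have sf : f = g ∨ f = k ∨ f = e :=
    third_neighbor_mem_of_four_cycle hG Q' R S P' ⟨hf.2.1, hf.2.2.1, hf.2.2.2, hf.1⟩ nfg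
      (fun h => nef h.symm)
  have sg : g = k ∨ g = e ∨ g = f :=
    third_neighbor_mem_of_four_cycle hG R' S P' Q ⟨hg.2.2.1, hg.2.2.2, hg.1, hg.2.1⟩ ngk
      (fun h => nfg h.symm)
  have sk : k = e ∨ k = f ∨ k = g :=
    third_neighbor_mem_of_four_cycle hG S' P' Q R ⟨hk.2.2.2, hk.1, hk.2.1, hk.2.2.1⟩ nke
      (fun h => ngk h.symm)
  have ne : ¬ (e = f ∧ f = g ∧ g = k) := by
    rintro ⟨rfl, rfl, rfl⟩
    have E := adj_iff_of_degree_three (hcubic e) hpe.symm hqf.symm hrg.symm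
      hnd.1.1 hnd.1.2.1 hnd.2.1.1 s
    rcases E.1 hsk.symm with h | h | h
    exacts [hnd.1.2.2 h.symm, hnd.2.1.2 h.symm, hnd.2.2 h.symm]
  have pairs : e = g ∧ f = k ∨ e = f ∧ g = k ∨ e = k ∧ f = g := by
    clear no P Q R S P' Q' R' S' hG hcubic
    grind
  rcases pairs with ⟨rfl, rfl⟩ | ⟨rfl, rfl⟩ | ⟨rfl, rfl⟩
  · exact no f q p s r e (by grind) hqf.symm hpq.symm hrs.symm hrg hsk.symm hqr hpe
  · exact nfg (adj_of_triangles hcubic hG (by clear no; simp; grind) hpq hqr hrs hsp hpe hqf hrg hsk)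
  · exact nef (adj_of_triangles hcubic hG (by clear no; simp; grind)
      hqr hrs hsp hpq hqf hrg hsk hpe).symm

end Ladders

/-- A (finite, connected) simple 3-regular graph satisfies `CD(0,∞)` at
every vertex iff it is isomorphic to a prism graph `Y n` with `n ≥ 3` or to a Möbius
ladder `M k` with `k ≥ 2`. -/
theorem cubic_CD_iff_prism_or_mobius {V : Type*} [Fintype V] (G : SimpleGraph V)
    [∀ v, Fintype (G.neighborSet v)]
    (hconn : G.Connected) (hcubic : ∀ v : V, G.degree v = 3) :
    (∀ x : V, SatisfiesCD G x) ↔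
      ((∃ n : ℕ, 3 ≤ n ∧ Nonempty (G ≃g prismGraph n)) ∨
        (∃ k : ℕ, 2 ≤ k ∧ Nonempty (G ≃g mobiusLadder k))) := by
  constructor
  · intro hCD
    have hG := edgesInShortCycles_of_satisfiesCD hcubic hCD
    have := hconn.nonempty
    obtain ⟨p, q, r, s, hnd, hpq, hqr, hrs, hsp⟩ := exists_four_cycle hcubic hG
    have hpr : G.Adj p r → G.Adj q s :=
      adj_of_adj_of_four_cycle hcubic hG hnd hpq hqr hrs hsp
    have hqs : G.Adj q s → G.Adj p r := fun h =>
      (adj_of_adj_of_four_cycle hcubic hG (by simp at hnd ⊢; grind) hqr hrs hsp hpq h).symm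
    by_cases hd : G.Adj p r
    · exact .inr ⟨2, le_rfl, (IsLadder.of_four_cycle hnd hpq hqr hrs hsp).nonempty_iso_mobiusLadder
        hconn hcubic le_rfl (hpr hd) hd.symm⟩
    obtain ⟨a, b, h⟩ := exists_isLadder_three hcubic hG hnd hpq hqr hrs hsp hd (fun h => hd (hqs h))
    obtain ⟨n, a, b, hn, h, hmax⟩ := h.exists_maximal
    obtain ⟨m, rfl⟩ : ∃ m, n = m + 3 := ⟨n - 3, by omega⟩
    obtain ⟨e, he₁, he₂, C⟩ := exists_third_neighbor (hcubic (a (m + 2)))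
      (h.left (m + 1) (by omega)).symm (h.rung (m + 2) (by omega))
      (h.disjoint _ _ (by omega) (by omega))
    obtain ⟨f, hf₁, hf₂, D⟩ := exists_third_neighbor (hcubic (b (m + 2)))
      (h.right (m + 1) (by omega)).symm (h.rung (m + 2) (by omega)).symm
      (h.disjoint _ _ (by omega) (by omega)).symm
    have hce : G.Adj (a (m + 2)) e := by simp [C]
    have hdf : G.Adj (b (m + 2)) f := by simp [D]
    have full : ∀ a b, IsLadder G (m + 3) a b → G.Adj (a (m + 2)) (a 0) →
        ¬ G.Adj (b (m + 2)) (a 0) := by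
      intro a b h ha hb
      have A₀ := adj_iff_of_degree_three (hcubic (a 0)) (h.left 0 (by omega))
        (h.rung 0 (by omega)) ha.symm (h.disjoint _ _ (by omega) (by omega))
        (fun r => by have := h.inj_left _ _ (by omega) (by omega) r; omega)
        (h.disjoint _ _ (by omega) (by omega)).symm (b (m + 2))
      rcases A₀.1 hb.symm with r | r | r
      · exact h.disjoint _ _ (by omega) (by omega) r.symm
      · have := h.inj_right _ _ (by omega) (by omega) r
        omega
      · exact h.disjoint _ _ (by omega) (by omega) r.symm
    rcases h.third_neighbor_mem hcubic hG hmax hce he₁.symm he₂.symm with rfl | rfl <;>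
      rcases h.swap.third_neighbor_mem hcubic hG (fun a' b' h' => hmax _ _ h'.swap) hdf
        hf₁.symm hf₂.symm with rfl | rfl
    · exact .inl ⟨m + 3, hn, h.nonempty_iso_prismGraph hconn hcubic hn hce hdf⟩
    · exact (full a b h hce hdf).elim
    · exact (full b a h.swap hdf hce).elim
    · exact .inr ⟨m + 3, by omega, h.nonempty_iso_mobiusLadder hconn hcubic (by omega) hce hdf⟩
  · rintro (⟨n, -, ⟨φ⟩⟩ | ⟨k, -, ⟨φ⟩⟩)
    · exact satisfiesCD_of_iso_prismGraph hcubic φ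
    · exact satisfiesCD_of_iso_mobiusLadder hcubic φ
end

section
/- There is no family of non-negatively curved 3-regular expanders in the Bakry-Émery sense: if (G_i)_{i∈ℕ} is a sequence of finite simple 3-regular graphs with |V(G_i)| → ∞ such that every vertex of every G_i satisfies CD(0,∞), then there is no ε > 0 with λ₁(G_i) ≥ ε for all i; equivalently, lim inf_i λ₁(G_i) = 0. -/
open Finset

variable {V : Type*}

/-- `Γ` as a sum over the neighbours: `2Γ(f,g)(x) = ∑_{y ∼ x} (f y − f x)(g y − g x)`. -/
theorem graphGamma_eq_sum (G : SimpleGraph V) [∀ v, Fintype (G.neighborSet v)]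
    (f g : V → ℝ) (x : V) :
    graphGamma G f g x = (∑ y ∈ G.neighborFinset x, (f y - f x) * (g y - g x)) / 2 := by
  simp only [graphGamma, graphLap, mul_sum, ← sum_sub_distrib]
  congr 1
  exact sum_congr rfl fun y _ => by ring

/-- A vertex of degree three has, besides a given neighbour, exactly two others. -/
theorem exists_neighborFinset_eq (G : SimpleGraph V) [∀ v, Fintype (G.neighborSet v)]
    [DecidableEq V] {x y : V} (hx : G.degree x = 3) (hxy : G.Adj x y) :
    ∃ r s, y ≠ r ∧ y ≠ s ∧ r ≠ s ∧ G.neighborFinset x = {y, r, s} := by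
  have hy : y ∈ G.neighborFinset x := by simpa using hxy
  have h2 : #((G.neighborFinset x).erase y) = 2 := by
    rw [card_erase_of_mem hy, G.card_neighborFinset_eq_degree, hx]
  obtain ⟨r, s, hrs, he⟩ := card_eq_two.1 h2
  have hr : r ∈ (G.neighborFinset x).erase y := by simp [he]
  have hs : s ∈ (G.neighborFinset x).erase y := by simp [he]
  refine ⟨r, s, (ne_of_mem_erase hr).symm, (ne_of_mem_erase hs).symm, hrs, ?_⟩
  rw [← insert_erase hy, he]

/-- Three distinct neighbours of a vertex of degree three are all of its neighbours. -/
theorem eq_or_eq_or_eq_of_adj (G : SimpleGraph V) [∀ v, Fintype (G.neighborSet v)]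
    {x a b c q : V} (hx : G.degree x = 3) (ha : G.Adj x a) (hb : G.Adj x b) (hc : G.Adj x c)
    (hab : a ≠ b) (hac : a ≠ c) (hbc : b ≠ c) (hq : G.Adj x q) : q = a ∨ q = b ∨ q = c := by
  classical
  have h3 : #({a, b, c} : Finset V) = 3 := card_eq_three.2 ⟨a, b, c, hab, hac, hbc, rfl⟩
  have hsub : ({a, b, c} : Finset V) ⊆ G.neighborFinset x := by
    intro z hz
    simp only [mem_insert, mem_singleton] at hz
    rcases hz with rfl | rfl | rfl <;> simpa
  have he := eq_of_subset_of_card_le hsub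
    (by rw [h3, G.card_neighborFinset_eq_degree, hx])
  have : q ∈ ({a, b, c} : Finset V) := by rw [he]; simpa using hq
  simpa using this

/-- In a cubic graph, `CD(0,∞)` at `x` forces every edge at `x` into a triangle or a 4-cycle. -/
theorem exists_short_cycle_of_satisfiesCD (G : SimpleGraph V) [∀ v, Fintype (G.neighborSet v)]
    (h3 : ∀ v, G.degree v = 3) {x y : V} (hcd : SatisfiesCD G x) (hxy : G.Adj x y) :
    ∃ y', G.Adj x y' ∧ y' ≠ y ∧ (G.Adj y y' ∨ ∃ z, z ≠ x ∧ G.Adj z y ∧ G.Adj z y') := by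
  classical
  by_contra! hno
  obtain ⟨a, b, hya, hyb, hab, hN⟩ := exists_neighborFinset_eq G (h3 x) hxy
  have adj_of_mem : ∀ {u v : V}, v ∈ G.neighborFinset u → G.Adj u v := by simp
  have hxa : G.Adj x a := adj_of_mem (by simp [hN])
  have hxb : G.Adj x b := adj_of_mem (by simp [hN])
  obtain ⟨p, q, hxp, hxq, hpq, hNy⟩ := exists_neighborFinset_eq G (h3 y) hxy.symm
  obtain ⟨c, d, hxc, hxd, hcd', hNa⟩ := exists_neighborFinset_eq G (h3 a) hxa.symm
  obtain ⟨e, g, hxe, hxg, heg, hNb⟩ := exists_neighborFinset_eq G (h3 b) hxb.symm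
  have hyp : G.Adj y p := adj_of_mem (by simp [hNy])
  have hyq : G.Adj y q := adj_of_mem (by simp [hNy])
  have hac : G.Adj a c := adj_of_mem (by simp [hNa])
  have had : G.Adj a d := adj_of_mem (by simp [hNa])
  have hbe : G.Adj b e := adj_of_mem (by simp [hNb])
  have hbg : G.Adj b g := adj_of_mem (by simp [hNb])
  set f : V → ℝ := fun v =>
    if v = x then 0 else if v = y then -2 else if G.Adj x v then 1 else
      if G.Adj v y then -4 else 2 with hf
  have fx : f x = 0 := by simp [hf]
  have fy : f y = -2 := by simp [hf, hxy.ne']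
  have fa : f a = 1 := by simp [hf, hxa.ne', hya.symm, hxa]
  have fb : f b = 1 := by simp [hf, hxb.ne', hyb.symm, hxb]
  have far : ∀ {v}, x ≠ v → G.Adj y v → f v = -4 := by
    intro v hxv hyv
    have hnxv : ¬ G.Adj x v := fun h => (hno v h hyv.ne').1 hyv
    simp [hf, hxv.symm, hyv.ne', hnxv, hyv.symm]
  have near : ∀ {u v}, x ≠ v → G.Adj u v → G.Adj x u → u ≠ y → f v = 1 ∨ f v = 2 := by
    intro u v hxv huv hxu huy
    obtain ⟨h1, h2⟩ := hno u hxu huy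
    have hvy : v ≠ y := fun h => h1 (h ▸ huv.symm)
    have hnvy : ¬ G.Adj v y := fun h => h2 v hxv.symm h huv.symm
    by_cases hxv' : G.Adj x v <;> simp [hf, hxv.symm, hvy, hxv', hnvy]
  have fp := far hxp hyp
  have fq := far hxq hyq
  have key := hcd f
  have sum_nbrs : ∀ {u r s t : V} (F : V → ℝ), r ≠ s → r ≠ t → s ≠ t →
      G.neighborFinset u = {r, s, t} → ∑ v ∈ G.neighborFinset u, F v = F r + F s + F t := by
    intro u r s t F hrs hrt hst h
    rw [h, sum_insert (by simp [hrs, hrt]), sum_pair hst, add_assoc]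
  have lx : graphLap G f x = 0 := by
    rw [graphLap, sum_nbrs _ hya hyb hab hN, fx, fy, fa, fb]
    norm_num
  have ly : graphLap G f y = -2 := by
    rw [graphLap, sum_nbrs _ hxp hxq hpq hNy, fx, fy, fp, fq]
    norm_num
  have la : graphLap G f a = f c + f d - 3 := by
    rw [graphLap, sum_nbrs _ hxc hxd hcd' hNa, fx, fa]
    ring
  have lb : graphLap G f b = f e + f g - 3 := by
    rw [graphLap, sum_nbrs _ hxe hxg heg hNb, fx, fb]
    ring
  rw [graphGamma2, graphLap, sum_nbrs _ hya hyb hab hN] at key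
  simp only [graphGamma_eq_sum] at key
  simp only [sum_nbrs _ hya hyb hab hN, sum_nbrs _ hxp hxq hpq hNy, sum_nbrs _ hxc hxd hcd' hNa,
    sum_nbrs _ hxe hxg heg hNb, lx, ly, la, lb, fx, fy, fa, fb, fp, fq] at key
  rcases near hxc hac hxa hya.symm with fc | fc <;>
  rcases near hxd had hxa hya.symm with fd | fd <;>
  rcases near hxe hbe hxb hyb.symm with fe | fe <;>
  rcases near hxg hbg hxb hyb.symm with fg | fg <;>
  · rw [fc, fd, fe, fg] at key
    norm_num at key

/-- In a connected graph every vertex other than `o` has a neighbour closer to `o`. -/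
theorem exists_adj_dist_lt (G : SimpleGraph V) (hc : G.Connected) {o v : V} {k : ℕ}
    (hv : G.dist o v = k + 1) : ∃ u, G.Adj v u ∧ G.dist o u = k := by
  obtain ⟨w, hw⟩ := hc.exists_walk_length_eq_dist v o
  rw [G.dist_comm, hv] at hw
  cases w with
  | nil => simp at hw
  | @cons _ u _ h p =>
    refine ⟨u, h, ?_⟩
    have h1 : G.dist o u ≤ k := by
      rw [G.dist_comm]
      have := G.dist_le p
      simp only [SimpleGraph.Walk.length_cons] at hw
      omega
    have h2 := h.diff_dist_adj (u := o)
    omega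

/-- If every edge of a cubic graph lies in a triangle or a 4-cycle, then a vertex at distance at
least two from `o` with two outward neighbours shares one of them with another vertex of its
sphere that has at most one outward neighbour. -/
theorem exists_sibling_of_two_outward (G : SimpleGraph V) [∀ v, Fintype (G.neighborSet v)]
    (hc : G.Connected) (h3 : ∀ v, G.degree v = 3)
    (hcyc : ∀ x y, G.Adj x y →
      ∃ y', G.Adj x y' ∧ y' ≠ y ∧ (G.Adj y y' ∨ ∃ z, z ≠ x ∧ G.Adj z y ∧ G.Adj z y'))
    {o v w w' : V} {k : ℕ} (hv : G.dist o v = k + 2) (hw : G.dist o w = k + 3)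
    (hw' : G.dist o w' = k + 3) (hvw : G.Adj v w) (hvw' : G.Adj v w') (hne : w ≠ w') :
    ∃ z, G.dist o z = k + 2 ∧ (G.Adj z w ∨ G.Adj z w') ∧
      ∀ c c', G.Adj z c → G.Adj z c' → G.dist o c = k + 3 → G.dist o c' = k + 3 → c = c' := by
  have hd : ∀ {a b}, G.Adj a b →
      G.dist o b = G.dist o a ∨ G.dist o b = G.dist o a + 1 ∨ G.dist o b + 1 = G.dist o a := by
    intro a b h
    have := h.diff_dist_adj (u := o)
    omega
  have hne_of : ∀ {a b}, G.dist o a ≠ G.dist o b → a ≠ b := fun h h' => h (h' ▸ rfl)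
  obtain ⟨u, hvu, hu⟩ := exists_adj_dist_lt G hc hv
  have hNv : ∀ q, G.Adj v q → q = u ∨ q = w ∨ q = w' := fun q hq =>
    eq_or_eq_or_eq_of_adj G (h3 v) hvu hvw hvw' (hne_of (by omega)) (hne_of (by omega)) hne hq
  obtain ⟨y', hvy', hy'u, hcase⟩ := hcyc v u hvu
  have hy'd : G.dist o y' = k + 3 := by
    rcases hNv y' hvy' with rfl | rfl | rfl
    · exact absurd rfl hy'u
    · exact hw
    · exact hw'
  rcases hcase with h | ⟨z, hzv, hzu, hzy'⟩
  · have := hd h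
    omega
  have hz : G.dist o z = k + 2 := by
    have h1 := hd hzu
    have h2 := hd hzy'
    omega
  refine ⟨z, hz, ?_, ?_⟩
  · rcases hNv y' hvy' with rfl | rfl | rfl
    · exact absurd rfl hy'u
    · exact Or.inl hzy'
    · exact Or.inr hzy'
  intro c c' hzc hzc' hc1 hc2
  by_contra hcc
  have hNz : ∀ q, G.Adj z q → q = u ∨ q = c ∨ q = c' := fun q hq =>
    eq_or_eq_or_eq_of_adj G (h3 z) hzu hzc hzc' (hne_of (by omega)) (hne_of (by omega)) hcc hq
  obtain ⟨t, hut, ht⟩ := exists_adj_dist_lt G hc hu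
  obtain ⟨q, huq, hqt, hcase⟩ := hcyc u t hut
  have hq : q = v ∨ q = z := by
    rcases eq_or_eq_or_eq_of_adj G (h3 u) hut hvu.symm hzu.symm (hne_of (by omega))
      (hne_of (by omega)) hzv.symm huq with h | h
    · exact absurd h hqt
    · exact h
  have hqd : G.dist o q = k + 2 := by rcases hq with rfl | rfl <;> assumption
  rcases hcase with h | ⟨p, hpu, hpt, hpq⟩
  · have := hd h
    omega
  have hpd := hd hpt
  rcases hq with rfl | rfl
  · rcases hNv p hpq.symm with rfl | rfl | rfl
    · exact hpu rfl
    · omega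
    · omega
  · rcases hNz p hpq.symm with rfl | rfl | rfl
    · exact hpu rfl
    · omega
    · omega

/-- Under the same hypothesis the sphere sizes are non-increasing from radius two on. -/
theorem card_sphere_succ_le (G : SimpleGraph V) [Fintype V] [∀ v, Fintype (G.neighborSet v)]
    (hc : G.Connected) (h3 : ∀ v, G.degree v = 3)
    (hcyc : ∀ x y, G.Adj x y →
      ∃ y', G.Adj x y' ∧ y' ≠ y ∧ (G.Adj y y' ∨ ∃ z, z ≠ x ∧ G.Adj z y ∧ G.Adj z y'))
    (o : V) (k : ℕ) :
    #{v | G.dist o v = k + 3} ≤ #{v | G.dist o v = k + 2} := by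
  classical
  set thin : V → Prop := fun z =>
    ∀ c c', G.Adj z c → G.Adj z c' → G.dist o c = k + 3 → G.dist o c' = k + 3 → c = c'
  have hparent : ∀ w, G.dist o w = k + 3 → ∃ v, G.Adj w v ∧ G.dist o v = k + 2 ∧
      ((∃ z, G.Adj z w ∧ G.dist o z = k + 2 ∧ thin z) → thin v) := by
    intro w hw
    by_cases h : ∃ z, G.Adj z w ∧ G.dist o z = k + 2 ∧ thin z
    · obtain ⟨z, hzw, hz, ht⟩ := h
      exact ⟨z, hzw.symm, hz, fun _ => ht⟩
    · obtain ⟨u, hwu, hu⟩ := exists_adj_dist_lt G hc hw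
      exact ⟨u, hwu, hu, fun h' => absurd h' h⟩
  choose! p hadj hdist hthin using hparent
  refine card_le_card_of_injOn p (fun w hw => ?_) (fun w hw w' hw' he => ?_)
  · simp only [coe_filter, mem_univ, true_and, Set.mem_ofPred_eq] at hw ⊢
    exact hdist w hw
  · simp only [coe_filter, mem_univ, true_and, Set.mem_ofPred_eq] at hw hw'
    by_contra hne
    have h1 := (hadj w hw).symm
    have h2 := (hadj w' hw').symm
    rw [← he] at h2
    obtain ⟨z, hz, hzadj, ht⟩ := exists_sibling_of_two_outward G hc h3 hcyc (hdist w hw) hw hw'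
      h1 h2 hne
    have hpt : thin (p w) := by
      rcases hzadj with h | h
      · exact hthin w hw ⟨z, h, hz, ht⟩
      · rw [he]
        exact hthin w' hw' ⟨z, h, hz, ht⟩
    exact hne (hpt w w' h1 h2 hw hw')

/-- Under the same hypothesis all spheres have at most nine vertices. -/
theorem card_sphere_le (G : SimpleGraph V) [Fintype V] [∀ v, Fintype (G.neighborSet v)]
    (hc : G.Connected) (h3 : ∀ v, G.degree v = 3)
    (hcyc : ∀ x y, G.Adj x y →
      ∃ y', G.Adj x y' ∧ y' ≠ y ∧ (G.Adj y y' ∨ ∃ z, z ≠ x ∧ G.Adj z y ∧ G.Adj z y'))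
    (o : V) (k : ℕ) : #{v | G.dist o v = k} ≤ 9 := by
  classical
  have step : ∀ j, #{v | G.dist o v = j + 1} ≤ #{v | G.dist o v = j} * 3 := by
    intro j
    refine le_trans (card_le_card (t := ({v | G.dist o v = j} : Finset V).biUnion
      fun u => G.neighborFinset u) fun v hv => ?_) (card_biUnion_le_card_mul _ _ _ fun u _ => ?_)
    · obtain ⟨u, hvu, hu⟩ := exists_adj_dist_lt G hc (by simpa using hv)
      simp only [mem_biUnion, mem_filter, mem_univ, true_and, SimpleGraph.mem_neighborFinset]
      exact ⟨u, hu, hvu.symm⟩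
    · rw [G.card_neighborFinset_eq_degree, h3]
  have h0 : #{v | G.dist o v = 0} ≤ 1 := by
    refine card_le_one.2 fun a ha b hb => ?_
    simp only [mem_filter, mem_univ, true_and, hc.dist_eq_zero_iff] at ha hb
    exact ha.symm.trans hb
  have h1 : #{v | G.dist o v = 1} ≤ _ := step 0
  have h2 : #{v | G.dist o v = 2} ≤ _ := step 1
  match k with
  | 0 => omega
  | 1 => omega
  | j + 2 =>
    induction j with
    | zero => exact h2.trans (by omega)
    | succ j ih => exact (card_sphere_succ_le G hc h3 hcyc o j).trans ih

theorem lapMat_eq_lapMatrix (G : SimpleGraph V) [Fintype V] [DecidableEq V]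
    [DecidableRel G.Adj] : lapMat G = G.lapMatrix ℝ := by
  ext i j
  simp only [lapMat, SimpleGraph.lapMatrix, SimpleGraph.degMatrix, Matrix.sub_apply,
    Matrix.diagonal_apply, SimpleGraph.adjMatrix_apply, SimpleGraph.degree_eq_sum_if_adj]
  congr!

theorem nonneg_of_lapMat_mulVec_eq (G : SimpleGraph V) [Fintype V] {t : ℝ} {v : V → ℝ}
    (hv : v ≠ 0) (h : (lapMat G).mulVec v = t • v) : 0 ≤ t := by
  classical
  rw [lapMat_eq_lapMatrix] at h
  have h1 := (G.posSemidef_lapMatrix ℝ).dotProduct_mulVec_nonneg v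
  rw [h, star_trivial, dotProduct_smul, smul_eq_mul] at h1
  have h2 : 0 < v ⬝ᵥ v := by
    rw [← star_trivial v]
    simpa using Matrix.dotProduct_star_self_pos_iff.2 hv
  exact nonneg_of_mul_nonneg_left h1 h2

theorem lambdaOne_nonneg (G : SimpleGraph V) [Fintype V] : 0 ≤ lambdaOne G :=
  Real.sInf_nonneg fun _ ⟨_, _, hv, h⟩ => nonneg_of_lapMat_mulVec_eq G hv h

/-- The variational bound: `λ₁ ∑ f² ≤ ∑_{i ∼ j} (f i − f j)²` for `f` of mean zero. -/
theorem lambdaOne_mul_sum_sq_le (G : SimpleGraph V) [Fintype V] [DecidableRel G.Adj]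
    (hc : G.Connected) (f : V → ℝ) (hf : ∑ v, f v = 0) :
    lambdaOne G * ∑ v, f v ^ 2 ≤
      (∑ i, ∑ j, if G.Adj i j then (f i - f j) ^ 2 else 0) / 2 := by
  classical
  rw [← SimpleGraph.lapMatrix_toLinearMap₂', Matrix.toLinearMap₂'_apply']
  have hA := G.isHermitian_lapMatrix ℝ
  set A := G.lapMatrix ℝ with hAdef
  set b := hA.eigenvectorBasis
  set c : V → ℝ := fun i => (b i : V → ℝ) ⬝ᵥ f
  have hsym : ∀ i, (b i : V → ℝ) ⬝ᵥ A.mulVec f = hA.eigenvalues i * c i := by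
    intro i
    rw [Matrix.dotProduct_mulVec, ← Matrix.mulVec_transpose, (G.isSymm_lapMatrix (R := ℝ)).eq,
      hA.mulVec_eigenvectorBasis, smul_dotProduct, smul_eq_mul]
  have parseval : ∀ g : V → ℝ, f ⬝ᵥ g = ∑ i, c i * ((b i : V → ℝ) ⬝ᵥ g) := by
    intro g
    have := b.sum_inner_mul_inner (WithLp.toLp 2 f) (WithLp.toLp 2 g)
    simp only [EuclideanSpace.inner_eq_star_dotProduct, star_trivial] at this
    rw [dotProduct_comm, ← this]
    refine sum_congr rfl fun i _ => ?_
    rw [dotProduct_comm g]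
  have hsq : ∑ v, f v ^ 2 = ∑ i, c i * c i := by
    rw [← parseval f, dotProduct]
    exact sum_congr rfl fun v _ => sq _
  rw [parseval, hsq, mul_sum]
  refine sum_le_sum fun i _ => ?_
  rw [hsym]
  have heig := hA.mulVec_eigenvectorBasis i
  have hb0 : (b i : V → ℝ) ≠ 0 := fun h => b.orthonormal.ne_zero i (WithLp.ofLp_injective 2 h)
  by_cases ht : hA.eigenvalues i = 0
  · have hconst : ∀ u v, b i u = b i v := by
      rw [ht, zero_smul, SimpleGraph.lapMatrix_mulVec_eq_zero_iff_forall_reachable] at heig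
      exact fun u v => heig u v (hc.preconnected u v)
    obtain ⟨o⟩ := hc.nonempty
    have : c i = 0 := by
      change ∑ v, b i v * f v = 0
      rw [sum_congr rfl fun v _ => by rw [hconst v o], ← mul_sum, hf, mul_zero]
    simp [this]
  · have : lambdaOne G ≤ hA.eigenvalues i := by
      refine csInf_le ⟨0, fun t ⟨_, v, hv, h⟩ => nonneg_of_lapMat_mulVec_eq G hv h⟩
        ⟨ht, _, hb0, ?_⟩
      rw [lapMat_eq_lapMatrix]
      exact heig
    nlinarith [mul_self_nonneg (c i)]

/-- If all spheres around `o` have at most nine vertices, some ball around `o` contains roughly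
half of the vertices. -/
theorem exists_half_ball (G : SimpleGraph V) [Fintype V] (o : V)
    (hS : ∀ k, #{v | G.dist o v = k} ≤ 9) :
    ∃ k, Fintype.card V ≤ 2 * #{v | G.dist o v ≤ k} ∧
      2 * #{v | G.dist o v ≤ k} ≤ Fintype.card V + 18 := by
  classical
  have hex : ∃ k, Fintype.card V ≤ 2 * #{v | G.dist o v ≤ k} := by
    refine ⟨univ.sup (G.dist o), ?_⟩
    rw [filter_true_of_mem fun v _ => le_sup (mem_univ v), card_univ]
    omega
  refine ⟨Nat.find hex, Nat.find_spec hex, ?_⟩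
  rcases hk : Nat.find hex with _ | k
  · have := hS 0
    simp only [Nat.le_zero]
    omega
  · have h1 := Nat.find_min hex (m := k) (by omega)
    have h2 : #{v | G.dist o v ≤ k + 1} ≤ #{v | G.dist o v ≤ k} + #{v | G.dist o v = k + 1} := by
      refine le_trans (card_le_card fun v hv => ?_) (card_union_le _ _)
      simp only [mem_filter, mem_univ, true_and, mem_union] at hv ⊢
      omega
    have := hS (k + 1)
    omega

theorem lambdaOne_mul_card_le (G : SimpleGraph V) [Fintype V] [∀ v, Fintype (G.neighborSet v)]
    (hc : G.Connected) (h3 : ∀ v, G.degree v = 3) (hcd : ∀ x, SatisfiesCD G x) :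
    lambdaOne G * (Fintype.card V - 18 : ℝ) ≤ 108 := by
  classical
  obtain ⟨o⟩ := hc.nonempty
  have hS := card_sphere_le G hc h3
    (fun x y hxy => exists_short_cycle_of_satisfiesCD G h3 (hcd x) hxy) o
  obtain ⟨k, hk1, hk2⟩ := exists_half_ball G o hS
  set B : Finset V := {v | G.dist o v ≤ k}
  set S : Finset V := {v | G.dist o v = k + 1}
  have hn : (0 : ℝ) < Fintype.card V := by exact_mod_cast Fintype.card_pos_iff.2 ⟨o⟩
  have hk1' : (Fintype.card V : ℝ) ≤ 2 * #B := by exact_mod_cast hk1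
  have hk2' : 2 * (#B : ℝ) ≤ Fintype.card V + 18 := by exact_mod_cast hk2
  have hbn : (#B : ℝ) ≤ Fintype.card V := by exact_mod_cast card_le_univ B
  set n := (Fintype.card V : ℝ)
  set b := (#B : ℝ)
  set χ : V → ℝ := fun v => if v ∈ B then 1 else 0
  have hχ : ∑ v, χ v = b := by simp [χ, b]
  have hmean : ∑ v, (n * χ v - b) = 0 := by
    rw [sum_sub_distrib, ← mul_sum, hχ]
    simp [n]
  have hsq : ∑ v, (n * χ v - b) ^ 2 = n * (b * (n - b)) := by
    have : ∀ v, (n * χ v - b) ^ 2 = (n ^ 2 - 2 * n * b) * χ v + b ^ 2 := by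
      intro v
      by_cases h : v ∈ B <;> simp only [χ, h, if_true, if_false] <;> ring
    simp_rw [this]
    rw [sum_add_distrib, ← mul_sum, hχ]
    simp only [sum_const, card_univ, nsmul_eq_mul]
    ring
  have hsphere : ∀ {i j}, G.Adj i j → i ∈ B → j ∉ B → j ∈ S := by
    intro i j hij hi hj
    have := hij.diff_dist_adj (u := o)
    simp only [B, S, mem_filter, mem_univ, true_and] at hi hj ⊢
    omega
  set σ : V → ℝ := fun v => if v ∈ S then 1 else 0
  have hterm : ∀ i j, (if G.Adj i j then (n * χ i - b - (n * χ j - b)) ^ 2 else 0) ≤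
      n ^ 2 * ((if G.Adj i j then σ i else 0) + (if G.Adj j i then σ j else 0)) := by
    intro i j
    by_cases hij : G.Adj i j
    · have hσ : ∀ v, 0 ≤ σ v := fun v => by simp only [σ]; split_ifs <;> norm_num
      simp only [hij, hij.symm, if_true]
      have h1 : (n * χ i - b - (n * χ j - b)) ^ 2 = n ^ 2 * (χ i - χ j) ^ 2 := by ring
      rw [h1]
      refine mul_le_mul_of_nonneg_left ?_ (sq_nonneg n)
      have hσi := hσ i
      have hσj := hσ j
      by_cases hi : i ∈ B <;> by_cases hj : j ∈ B
      · simp only [χ, hi, hj, if_true]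
        linarith
      · have : σ j = 1 := by simp [σ, hsphere hij hi hj]
        simp only [χ, hi, hj, if_true, if_false]
        linarith
      · have : σ i = 1 := by simp [σ, hsphere hij.symm hj hi]
        simp only [χ, hi, hj, if_true, if_false]
        linarith
      · simp only [χ, hi, hj, if_false]
        linarith
    · simp [hij, mt SimpleGraph.Adj.symm hij]
  have hrow : ∑ i, ∑ j, (if G.Adj i j then σ i else 0) ≤ 27 := by
    have : ∀ i, ∑ j, (if G.Adj i j then σ i else 0) = 3 * σ i := by
      intro i
      rw [← sum_filter, sum_const, nsmul_eq_mul,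
        show (univ.filter fun j => G.Adj i j) = G.neighborFinset i by ext; simp,
        G.card_neighborFinset_eq_degree, h3]
      norm_num
    simp_rw [this]
    rw [← mul_sum]
    have h9 : (#S : ℝ) ≤ 9 := by exact_mod_cast hS (k + 1)
    have : ∑ i, σ i = #S := by simp [σ]
    linarith
  have henergy : (∑ i, ∑ j, if G.Adj i j then (n * χ i - b - (n * χ j - b)) ^ 2 else 0) ≤
      n ^ 2 * 54 := by
    refine (sum_le_sum fun i _ => sum_le_sum fun j _ => hterm i j).trans ?_
    simp_rw [← mul_sum, sum_add_distrib]
    refine mul_le_mul_of_nonneg_left ?_ (sq_nonneg n)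
    rw [sum_comm (f := fun i j => if G.Adj j i then σ j else 0)]
    linarith
  have hray := lambdaOne_mul_sum_sq_le G hc (fun v => n * χ v - b) hmean
  rw [hsq] at hray
  have hcut : lambdaOne G * (b * (n - b)) ≤ n * 27 := by
    refine le_of_mul_le_mul_left ?_ hn
    linarith
  have hl := lambdaOne_nonneg G
  have hhalf : lambdaOne G * (n / 2 * (n - b)) ≤ lambdaOne G * (b * (n - b)) :=
    mul_le_mul_of_nonneg_left
      (mul_le_mul_of_nonneg_right (by linarith) (by linarith)) hl
  have hfin : lambdaOne G * (n - b) ≤ 54 := by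
    refine le_of_mul_le_mul_left ?_ hn
    linarith
  have : lambdaOne G * (n - 18) ≤ lambdaOne G * (2 * (n - b)) :=
    mul_le_mul_of_nonneg_left (by linarith) hl
  linarith

/-- There is no family of non-negatively curved 3-regular expanders in
the Bakry–Émery sense: for a sequence of finite connected simple 3-regular graphs with
`|V(Gᵢ)| → ∞` satisfying `CD(0,∞)` at every vertex, no `ε > 0` satisfies `λ₁(Gᵢ) ≥ ε`
for all `i`; equivalently `liminf λ₁(Gᵢ) = 0`. -/
theorem no_bakry_emery_nonneg_cubic_expanders (V : ℕ → Type) [∀ i, Fintype (V i)]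
    (G : ∀ i, SimpleGraph (V i)) [∀ i, ∀ v : V i, Fintype ((G i).neighborSet v)]
    (hconn : ∀ i, (G i).Connected)
    (hcubic : ∀ i (v : V i), (G i).degree v = 3)
    (hcard : Filter.Tendsto (fun i => Fintype.card (V i)) Filter.atTop Filter.atTop)
    (hcurv : ∀ i (x : V i), SatisfiesCD (G i) x) :
    (¬ ∃ ε : ℝ, 0 < ε ∧ ∀ i, ε ≤ lambdaOne (G i)) ∧
      Filter.liminf (fun i => lambdaOne (G i)) Filter.atTop = 0 := by
  have hlim : Filter.Tendsto (fun i => lambdaOne (G i)) Filter.atTop (nhds 0) := by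
    have hn : Filter.Tendsto (fun i => (Fintype.card (V i) : ℝ) - 18) Filter.atTop
        Filter.atTop :=
      Filter.tendsto_atTop_add_const_right _ _ (tendsto_natCast_atTop_atTop.comp hcard)
    refine tendsto_of_tendsto_of_tendsto_of_le_of_le' tendsto_const_nhds
      (hn.const_div_atTop 108) (.of_forall fun i => lambdaOne_nonneg (G i)) ?_
    filter_upwards [hn.eventually_gt_atTop 0] with i hi
    rw [le_div_iff₀ hi]
    exact lambdaOne_mul_card_le (G i) (hconn i) (hcubic i) (hcurv i)
  refine ⟨fun ⟨ε, hε, h⟩ => ?_, hlim.liminf_eq⟩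
  exact absurd (ge_of_tendsto' hlim h) (not_le.2 hε)
end
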